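/- arXiv:math/0110189 — 4 statements merged into one kernel-verified Lean document; each statement's English description precedes it below -/
import Mathlib

section
/- Let E D_n denote the expected number of distinct part sizes in a composition of n chosen uniformly at random among all 2^{n-1} compositions of n. Then, as n → ∞, E D_n = log₂ n + γ/ln 2 − 3/2 + g(log₂ n) + o(1); that is, E D_n − log₂ n − γ/ln 2 + 3/2 − g(log₂ n) tends to 0 as n → ∞. -/
open Real Filter

/-- The expected number of distinct part sizes in a uniformly random
composition of `n` (the average over all `2^(n-1)` compositions). -/
noncomputable def expectedDistinctParts (n : ℕ) : ℝ :=
  (∑ c : Composition n, (c.blocks.toFinset.card : ℝ)) / 2 ^ (n - 1)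

/-- The periodic function `g` from the theorem:
`g(x) = -x - γ/ln 2 + 1/2 - ∑_{m=-∞}^{0} exp(-2^{x-m}) + ∑_{m=1}^{∞} (1 - exp(-2^{x-m}))`,
where the sum over `m ≤ 0` is reindexed by `m = -j`, `j : ℕ`, and the sum over `m ≥ 1`
by `m = j+1`, `j : ℕ`. -/
noncomputable def g (x : ℝ) : ℝ :=
  -x - Real.eulerMascheroniConstant / Real.log 2 + 1 / 2
    - ∑' j : ℕ, Real.exp (-(2 : ℝ) ^ (x + j))
    + ∑' j : ℕ, (1 - Real.exp (-(2 : ℝ) ^ (x - (j + 1))))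

open Finset in
/-- lists of blocks of compositions of `n` without part `k` -/
def avoidF (k n : ℕ) : Finset (List ℕ) :=
  ((Finset.univ : Finset (Composition n)).filter (fun c => k ∉ c.blocks)).image
    (fun c => c.blocks)

lemma mem_avoidF (k n : ℕ) (l : List ℕ) :
    l ∈ avoidF k n ↔ (∀ i ∈ l, 0 < i) ∧ l.sum = n ∧ k ∉ l := by
  unfold avoidF
  simp only [Finset.mem_image, Finset.mem_filter, Finset.mem_univ, true_and]
  constructor
  · rintro ⟨c, hc, rfl⟩
    exact ⟨fun i hi => c.blocks_pos hi, c.blocks_sum, hc⟩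
  · rintro ⟨h1, h2, h3⟩
    exact ⟨⟨l, fun {i} hi => h1 i hi, h2⟩, h3, rfl⟩

lemma avoidF_card (k n : ℕ) : (avoidF k n).card =
    ((Finset.univ : Finset (Composition n)).filter (fun c => k ∉ c.blocks)).card := by
  unfold avoidF
  apply Finset.card_image_of_injective
  intro c d h
  exact Composition.ext h

lemma avoidF_zero (k : ℕ) : (avoidF k 0).card = 1 := by
  have : avoidF k 0 = {[]} := by
    ext l
    rw [mem_avoidF]
    simp only [Finset.mem_singleton]
    constructor
    · rintro ⟨h1, h2, h3⟩
      cases l with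
      | nil => rfl
      | cons a t =>
        have := h1 a (by simp)
        simp at h2
        omega
    · rintro rfl
      simp
  rw [this]; simp

lemma avoidF_succ (k n : ℕ) : avoidF k (n+1) =
    ((Finset.range (n+1)).filter (fun i => i + 1 ≠ k)).biUnion
      (fun i => (avoidF k (n - i)).image (fun l => (i+1) :: l)) := by
  ext l
  simp only [Finset.mem_biUnion, Finset.mem_image, mem_avoidF, Finset.mem_filter,
    Finset.mem_range]
  constructor
  · rintro ⟨h1, h2, h3⟩
    cases l with
    | nil => simp at h2
    | cons a t =>
      have ha := h1 a (by simp)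
      simp only [List.sum_cons] at h2
      simp only [List.mem_cons, not_or] at h3
      refine ⟨a - 1, ⟨by omega, by omega⟩, t, ⟨fun i hi => h1 i (by simp [hi]), by omega, h3.2⟩, ?_⟩
      congr 1; omega
  · rintro ⟨i, ⟨hi, hik⟩, t, ⟨h1, h2, h3⟩, rfl⟩
    refine ⟨?_, ?_, ?_⟩
    · intro j hj
      rcases List.mem_cons.1 hj with rfl | hj
      · omega
      · exact h1 j hj
    · simp only [List.sum_cons]; omega
    · simp only [List.mem_cons, not_or]
      exact ⟨fun h => hik h.symm, h3⟩

lemma avoidF_card_succ (k n : ℕ) : (avoidF k (n+1)).card =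
    ∑ i ∈ (Finset.range (n+1)).filter (fun i => i + 1 ≠ k), (avoidF k (n - i)).card := by
  rw [avoidF_succ, Finset.card_biUnion]
  · refine Finset.sum_congr rfl fun i _ => ?_
    apply Finset.card_image_of_injective
    intro a b h
    simpa using h
  · intro i _ j _ hij
    rw [Function.onFun, Finset.disjoint_left]
    intro l hl hl'
    simp only [Finset.mem_image] at hl hl'
    obtain ⟨a, _, rfl⟩ := hl
    obtain ⟨b, _, hb⟩ := hl'
    simp at hb
    omega

/-- number of compositions of `n` avoiding `k`, as a real -/
noncomputable def av (k n : ℕ) : ℝ := ((avoidF k n).card : ℝ)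

lemma av_nonneg (k n : ℕ) : 0 ≤ av k n := by unfold av; positivity

lemma av_zero (k : ℕ) : av k 0 = 1 := by unfold av; rw [avoidF_zero]; simp

lemma av_le (k n : ℕ) : av k (n+1) ≤ 2 ^ n := by
  unfold av
  rw [avoidF_card]
  have h := Finset.card_filter_le (Finset.univ : Finset (Composition (n+1)))
    (fun c => k ∉ c.blocks)
  rw [Finset.card_univ, composition_card] at h
  simp only [Nat.add_sub_cancel] at h
  exact_mod_cast h

lemma av_succ (k n : ℕ) (hk : 1 ≤ k) : av k (n+1) =
    ∑ i ∈ Finset.range (n+1), av k i - (if k ≤ n + 1 then av k (n+1-k) else 0) := by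
  have h1 : av k (n+1) = ∑ i ∈ (Finset.range (n+1)).filter (fun i => i + 1 ≠ k), av k (n - i) := by
    unfold av
    rw [avoidF_card_succ]
    push_cast
    rfl
  have h2 := Finset.sum_filter_add_sum_filter_not (Finset.range (n+1)) (fun i => i + 1 ≠ k)
    (fun i => av k (n - i))
  have h3 : ∑ i ∈ Finset.range (n+1), av k (n - i) = ∑ i ∈ Finset.range (n+1), av k i := by
    have := Finset.sum_range_reflect (fun i => av k i) (n+1)
    simpa using this
  have h4 : ∑ i ∈ (Finset.range (n+1)).filter (fun i => ¬ (i + 1 ≠ k)), av k (n - i)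
      = (if k ≤ n + 1 then av k (n+1-k) else 0) := by
    split_ifs with h
    · have : (Finset.range (n+1)).filter (fun i => ¬ (i + 1 ≠ k)) = {k - 1} := by
        ext i; simp; omega
      rw [this, Finset.sum_singleton]
      congr 1; omega
    · apply Finset.sum_eq_zero
      intro i hi
      simp at hi
      omega
  linarith

lemma av_rec (k m : ℕ) (hk : 1 ≤ k) :
    av k (m + k + 1) = 2 * av k (m + k) - av k (m+1) + av k m := by
  have h1 := av_succ k (m+k) hk
  have h2 := av_succ k (m+k-1) hk
  rw [show m + k - 1 + 1 = m + k by omega] at h2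
  rw [Finset.sum_range_succ] at h1
  simp only [show k ≤ m + k + 1 by omega, show k ≤ m + k by omega, if_true,
    show m + k + 1 - k = m + 1 by omega, show m + k - k = m by omega] at h1 h2
  linarith

lemma sum_av_lt (k n : ℕ) (hk : 1 ≤ k) (hn : n < k) :
    ∑ i ∈ Finset.range (n+1), av k i = 2 ^ n := by
  induction n with
  | zero => simp [av_zero]
  | succ n ih =>
    have h := av_succ k n hk
    rw [if_neg (by omega), ih (by omega)] at h
    rw [Finset.sum_range_succ, ih (by omega), h]
    ring

lemma av_lt (k n : ℕ) (hn : n + 1 < k) : av k (n+1) = 2 ^ n := by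
  rw [av_succ k n (by omega), sum_av_lt k n (by omega) (by omega), if_neg (by omega)]
  ring

lemma av_self (k : ℕ) : av (k+1) (k+1) = 2 ^ k - 1 := by
  rw [av_succ (k+1) k (by omega), sum_av_lt (k+1) k (by omega) (by omega), if_pos (by omega)]
  simp [av_zero]

lemma av_mono_aux (k n : ℕ) (hk : 1 ≤ k) : ∀ i, 1 ≤ i → i ≤ n → av k i ≤ av k n := by
  induction n with
  | zero => intro i h1 h2; omega
  | succ n ih =>
    intro i h1 h2
    rcases Nat.lt_or_ge n i with h | h
    · have : i = n + 1 := by omega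
      rw [this]
    refine (ih i h1 h).trans ?_
    rcases lt_trichotomy (n+1) k with h' | h' | h'
    · obtain ⟨p, rfl⟩ : ∃ p, n = p + 1 := ⟨n - 1, by omega⟩
      rw [av_lt k (p+1) h', av_lt k p (by omega)]
      exact pow_le_pow_right₀ (by norm_num) (by omega)
    · obtain ⟨p, rfl⟩ : ∃ p, n = p + 1 := ⟨n - 1, by omega⟩
      subst h'
      rw [av_self, av_lt _ p (by omega), pow_succ]
      have : (1:ℝ) ≤ 2 ^ p := one_le_pow₀ (by norm_num)
      linarith
    · obtain ⟨m, rfl⟩ : ∃ m, n = m + k := ⟨n - k, by omega⟩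
      have h3 := ih (m+1) (by omega) (by omega)
      have := av_rec k m hk
      have := av_nonneg k m
      linarith

/-- normalized -/
noncomputable def uu (k n : ℕ) : ℝ := 2 * av k n / 2 ^ n

lemma uu_nonneg (k n : ℕ) : 0 ≤ uu k n := by
  have := av_nonneg k n
  unfold uu; positivity

lemma uu_le_one (k n : ℕ) (hn : 1 ≤ n) : uu k n ≤ 1 := by
  obtain ⟨p, rfl⟩ : ∃ p, n = p + 1 := ⟨n - 1, by omega⟩
  unfold uu
  rw [div_le_one (by positivity), pow_succ]
  linarith [av_le k p]

lemma uu_rec (k m : ℕ) (hk : 1 ≤ k) :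
    uu k (m + k + 1) = uu k (m+k) - 2 * (1/2^(k+1)) * uu k (m+1) + 1/2^(k+1) * uu k m := by
  unfold uu
  rw [av_rec k m hk]
  simp only [pow_add, pow_one]
  field_simp

lemma uu_lt (k n : ℕ) (h1 : 1 ≤ n) (hn : n < k) : uu k n = 1 := by
  obtain ⟨p, rfl⟩ : ∃ p, n = p + 1 := ⟨n - 1, by omega⟩
  unfold uu
  rw [av_lt k p hn, pow_succ]
  field_simp

lemma uu_self (k : ℕ) (hk : 1 ≤ k) : uu k k = 1 - 4 * (1/2^(k+1)) := by
  obtain ⟨p, rfl⟩ : ∃ p, k = p + 1 := ⟨k - 1, by omega⟩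
  unfold uu
  rw [av_self]
  simp only [pow_succ]
  field_simp
  ring

lemma uu_zero (k : ℕ) : uu k 0 = 2 := by simp [uu, av_zero]

lemma uu_half (k m : ℕ) (hk : 1 ≤ k) (hm : 1 ≤ m) : uu k m ≤ 2 * uu k (m+1) := by
  have := av_mono_aux k (m+1) hk m hm (by omega)
  unfold uu
  rw [pow_succ, div_le_iff₀ (by positivity)]
  field_simp
  linarith

lemma uu_step_late (k n : ℕ) (hk : 1 ≤ k) (hn : k + 1 ≤ n) : uu k (n+1) ≤ uu k n := by
  obtain ⟨m, rfl⟩ : ∃ m, n = m + k := ⟨n - k, by omega⟩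
  rw [uu_rec k m hk]
  have h := uu_half k m hk (by omega)
  have hs : (0:ℝ) < 1/2^(k+1) := by positivity
  nlinarith

lemma uu_tendsto (k : ℕ) (hk : 1 ≤ k) : Tendsto (fun n => uu k n) atTop (nhds 0) := by
  have hanti : Antitone (fun n => uu k (n + (k+1))) := by
    apply antitone_nat_of_succ_le
    intro n
    have := uu_step_late k (n + (k+1)) hk (by omega)
    rwa [show n + 1 + (k+1) = n + (k+1) + 1 by omega]
  have hbdd : BddBelow (Set.range (fun n => uu k (n + (k+1)))) :=
    ⟨0, by rintro _ ⟨n, rfl⟩; exact uu_nonneg _ _⟩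
  have h0 := tendsto_atTop_ciInf hanti hbdd
  rw [tendsto_add_atTop_iff_nat (f := fun n => uu k n)] at h0
  set L := ⨅ n, uu k (n + (k+1))
  have ha : Tendsto (fun m => uu k (m + k + 1)) atTop (nhds L) :=
    (tendsto_add_atTop_iff_nat (f := fun n => uu k n) (k+1)).2 h0
  have hb : Tendsto (fun m => uu k (m + k)) atTop (nhds L) :=
    (tendsto_add_atTop_iff_nat (f := fun n => uu k n) k).2 h0
  have hc : Tendsto (fun m => uu k (m + 1)) atTop (nhds L) :=
    (tendsto_add_atTop_iff_nat (f := fun n => uu k n) 1).2 h0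
  have hd := (hb.sub (hc.const_mul (2 * (1/2^(k+1))))).add (h0.const_mul (1/2^(k+1)))
  have he := tendsto_nhds_unique ha (hd.congr fun m => (uu_rec k m hk).symm)
  have hs : (0:ℝ) < 1/2^(k+1) := by positivity
  have : L = 0 := by
    have : (1/2^(k+1) : ℝ) * L = 0 := by linarith
    rcases mul_eq_zero.1 this with h | h
    · exact absurd h hs.ne'
    · exact h
  rwa [this] at h0

lemma uu_step (k n : ℕ) (hk : 2 ≤ k) (hn : 1 ≤ n) :
    uu k (n+1) ≤ uu k n ∧ uu k n - uu k (n+1) ≤ 4 * (1/2^(k+1)) := by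
  have hs : (0:ℝ) < 1/2^(k+1) := by positivity
  rcases lt_trichotomy (n+1) k with h' | h' | h'
  · rw [uu_lt k n hn (by omega), uu_lt k (n+1) (by omega) h']
    constructor <;> linarith
  · rw [uu_lt k n hn (by omega), h', uu_self k (by omega)]
    constructor <;> linarith
  · obtain ⟨m, rfl⟩ : ∃ m, n = m + k := ⟨n - k, by omega⟩
    have hr := uu_rec k m (by omega)
    rcases Nat.eq_zero_or_pos m with rfl | hm
    · rw [uu_lt k (0+1) (by omega) (by omega), uu_zero] at hr
      constructor <;> linarith
    · refine ⟨uu_step_late k _ (by omega) (by omega), ?_⟩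
      have h1 := uu_le_one k (m+1) (by omega)
      have h2 := uu_nonneg k m
      nlinarith [mul_nonneg hs.le h2]

lemma uu_lip (k n d : ℕ) (hk : 2 ≤ k) (hn : 1 ≤ n) :
    uu k (n+d) ≤ uu k n ∧ uu k n - uu k (n+d) ≤ 4 * d * (1/2^(k+1)) := by
  induction d with
  | zero => simp
  | succ d ih =>
    have := uu_step k (n+d) hk (by omega)
    rw [← add_assoc]
    push_cast
    constructor <;> linarith

lemma uu_exp_bound_init (k n : ℕ) (hk : 2 ≤ k) (hn : 1 ≤ n) (h : n < k + 2) :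
    |uu k n - Real.exp (-(n * (1/2^(k+1))))| ≤ (4 * k + 4) * (1/2^(k+1)) := by
  have hs : (0:ℝ) < 1/2^(k+1) := by positivity
  have h1 : uu k n ≤ 1 := uu_le_one k n hn
  have h2 : 1 - 4 * (1/2^(k+1)) ≤ uu k n := by
    rcases lt_trichotomy n k with h' | h' | h'
    · rw [uu_lt k n hn h']; linarith
    · rw [h', uu_self k (by omega)]
    · have : n = 0 + k + 1 := by omega
      have hr := uu_rec k 0 (by omega)
      rw [uu_lt k (0+1) (by omega) (by omega), uu_zero, zero_add, uu_self k (by omega)] at hr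
      rw [this, zero_add, hr]; linarith
  have h3 : Real.exp (-(n * (1/2^(k+1)))) ≤ 1 := by
    apply Real.exp_le_one_iff.2
    have : (0:ℝ) ≤ n * (1/2^(k+1)) := by positivity
    linarith
  have h4 := Real.add_one_le_exp (-((n:ℝ) * (1/2^(k+1))))
  have h5 : (n:ℝ) ≤ k + 1 := by exact_mod_cast (by omega : n ≤ k + 1)
  have h6 : (n:ℝ) * (1/2^(k+1)) ≤ (k+1) * (1/2^(k+1)) := by gcongr
  have h7 : 0 ≤ (k:ℝ) * (1/2^(k+1)) := by positivity
  rw [abs_le]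
  constructor <;> linarith

lemma uu_exp_bound (k n : ℕ) (hk : 2 ≤ k) (hn : 1 ≤ n) :
    |uu k n - Real.exp (-(n * (1/2^(k+1))))| ≤ (4 * k + 4) * (1/2^(k+1)) := by
  induction n with
  | zero => omega
  | succ n ih =>
    rcases Nat.lt_or_ge (n+1) (k+2) with h | h
    · exact uu_exp_bound_init k (n+1) hk hn h
    have ih := ih (by omega)
    obtain ⟨m, rfl⟩ : ∃ m, n = m + k := ⟨n - k, by omega⟩
    have hr := uu_rec k m (by omega)
    have hl1 := uu_lip k m 1 hk (by omega)
    have hl2 := uu_lip k (m+1) (k-1) hk (by omega)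
    rw [show m + 1 + (k-1) = m + k by omega, Nat.cast_sub (by omega : 1 ≤ k)] at hl2
    have hexp : Real.exp (-(((m + k + 1 : ℕ) : ℝ) * (1/2^(k+1)))) =
        Real.exp (-(((m + k : ℕ) : ℝ) * (1/2^(k+1)))) * Real.exp (-(1/2^(k+1))) := by
      rw [← Real.exp_add]; congr 1; push_cast; ring
    have hs : (0:ℝ) < 1/2^(k+1) := by positivity
    have hs1 : (1/2^(k+1) : ℝ) ≤ 1 := by
      rw [div_le_one (by positivity)]
      exact one_le_pow₀ (by norm_num)
    have h3 : Real.exp (-(((m + k : ℕ) : ℝ) * (1/2^(k+1)))) ≤ 1 := by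
      apply Real.exp_le_one_iff.2
      have : (0:ℝ) ≤ ((m + k : ℕ) : ℝ) * (1/2^(k+1)) := by positivity
      linarith
    have h3' := Real.exp_pos (-(((m + k : ℕ) : ℝ) * (1/2^(k+1))))
    rw [hr, hexp]
    set s : ℝ := 1/2^(k+1) with hsdef
    set E := Real.exp (-(((m + k : ℕ) : ℝ) * s))
    have h4 := Real.add_one_le_exp (-s)
    have h5 : Real.exp (-s) ≤ 1 - s + s^2 := by
      have := Real.abs_exp_sub_one_sub_id_le (x := -s) (by rw [abs_neg, abs_of_pos hs]; exact hs1)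
      have := (abs_le.1 this).2
      linarith [neg_sq s]
    have hd1 : 0 ≤ E * (Real.exp (-s) - 1 + s) := mul_nonneg h3'.le (by linarith)
    have hd2 : E * (Real.exp (-s) - 1 + s) ≤ s^2 := by
      calc _ ≤ 1 * (Real.exp (-s) - 1 + s) := mul_le_mul_of_nonneg_right h3 (by linarith)
        _ ≤ _ := by linarith
    have hd3 : 0 ≤ s * (uu k (m+1) - uu k (m+k)) := mul_nonneg hs.le (by linarith [hl2.1])
    have hd4 := mul_le_mul_of_nonneg_left hl2.2 hs.le
    have hd5 : 0 ≤ s * (uu k m - uu k (m+1)) := mul_nonneg hs.le (by linarith [hl1.1])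
    have hd6 := mul_le_mul_of_nonneg_left hl1.2 hs.le
    push_cast at hd4 hd6
    obtain ⟨i1, i2⟩ := abs_le.1 ih
    have i1' := mul_le_mul_of_nonneg_left i1 (by linarith : 0 ≤ 1 - s)
    have i2' := mul_le_mul_of_nonneg_left i2 (by linarith : 0 ≤ 1 - s)
    have hks : 0 ≤ (k:ℝ) * s^2 := by positivity
    have hs2 : 0 ≤ s^2 := by positivity
    rw [abs_le]
    constructor <;> nlinarith

lemma uu_exp_bound' (k n : ℕ) (hk : 1 ≤ k) (hn : 1 ≤ n) :
    |uu k n - Real.exp (-(n * (1/2^(k+1))))| ≤ (4 * k + 4) * (1/2^(k+1)) := by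
  rcases Nat.lt_or_ge 1 k with h | h
  · exact uu_exp_bound k n h hn
  · obtain rfl : k = 1 := by omega
    have h1 := uu_le_one 1 n hn
    have h2 := uu_nonneg 1 n
    have h3 : Real.exp (-((n:ℝ) * (1/2^(1+1)))) ≤ 1 := by
      apply Real.exp_le_one_iff.2
      have : (0:ℝ) ≤ n * (1/2^(1+1)) := by positivity
      linarith
    have h4 := Real.exp_pos (-((n:ℝ) * (1/2^(1+1))))
    rw [abs_le]
    have h5 : (4 * ((1:ℕ):ℝ) + 4) * (1/2^(1+1)) = 2 := by norm_num
    rw [h5]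
    constructor <;> linarith

lemma expected_eq (n : ℕ) (hn : 1 ≤ n) :
    expectedDistinctParts n = ∑ k ∈ Finset.range n, (1 - uu (k+1) n) := by
  have h1 : ∀ c : Composition n, (c.blocks.toFinset.card : ℝ)
      = ∑ k ∈ Finset.range n, (if k + 1 ∈ c.blocks then (1:ℝ) else 0) := by
    intro c
    rw [Finset.sum_boole]
    congr 1
    symm
    apply Finset.card_bij (fun k _ => k + 1)
    · intro k hk
      simp at hk
      simp [hk.2]
    · intro a _ b _ h
      omega
    · intro b hb
      simp at hb
      have h1 := c.blocks_pos hb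
      have h2 := c.blocks_le hb
      refine ⟨b - 1, ?_, by omega⟩
      simp [show b - 1 + 1 = b by omega, hb]
      omega
  unfold expectedDistinctParts
  simp_rw [h1]
  rw [Finset.sum_comm, Finset.sum_div]
  refine Finset.sum_congr rfl fun k _ => ?_
  rw [Finset.sum_boole]
  have h2 := Finset.card_filter_add_card_filter_not
    (s := (Finset.univ : Finset (Composition n))) (fun c => k + 1 ∈ c.blocks)
  rw [← avoidF_card, Finset.card_univ, composition_card] at h2
  have h3 : ((Finset.univ.filter (fun c : Composition n => k + 1 ∈ c.blocks)).card : ℝ)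
      + av (k+1) n = 2 ^ (n-1) := by
    unfold av
    exact_mod_cast h2
  obtain ⟨p, rfl⟩ : ∃ p, n = p + 1 := ⟨n - 1, by omega⟩
  rw [eq_sub_of_add_eq h3]
  unfold uu
  simp only [Nat.add_sub_cancel, pow_succ]
  field_simp

lemma pow_logb_add (n : ℕ) (hn : 1 ≤ n) (y : ℝ) :
    (2:ℝ) ^ (Real.logb 2 n + y) = n * 2 ^ y := by
  rw [Real.rpow_add (by norm_num), Real.rpow_logb (by norm_num) (by norm_num)
    (by exact_mod_cast hn)]

lemma summable_bd : Summable (fun j : ℕ => (4 * ((j+1 : ℕ) : ℝ) + 4) * (1/2^((j+1)+1))) := by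
  have h1 : Summable (fun j : ℕ => (j:ℝ) ^ 1 * (1/2:ℝ)^j) :=
    summable_pow_mul_geometric_of_norm_lt_one 1 (by norm_num)
  have h2 : Summable (fun j : ℕ => (1/2:ℝ)^j) := summable_geometric_of_lt_one (by norm_num) (by norm_num)
  refine (h1.add (h2.mul_left 2)).congr fun j => ?_
  push_cast
  simp only [pow_succ, one_div, inv_pow, pow_zero]
  field_simp
  ring

lemma exp_summable (n : ℝ) (hn : 0 ≤ n) (d : ℕ) :
    Summable (fun j : ℕ => 1 - Real.exp (-(n * (1/2^(j+d))))) := by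
  have h2 : Summable (fun j : ℕ => (1/2:ℝ)^j) := summable_geometric_of_lt_one (by norm_num) (by norm_num)
  refine Summable.of_nonneg_of_le ?_ ?_ (h2.mul_left n)
  · intro j
    have : Real.exp (-(n * (1/2^(j+d)))) ≤ 1 := by
      apply Real.exp_le_one_iff.2
      have : (0:ℝ) ≤ n * (1/2^(j+d)) := by positivity
      linarith
    linarith
  · intro j
    have h4 := Real.add_one_le_exp (-(n * (1/2^(j+d))))
    have h5 : n * (1/2^(j+d)) ≤ n * (1/2:ℝ)^j := by
      rw [one_div_pow]
      gcongr
      · norm_num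
      · omega
    linarith

lemma final_eq (n : ℕ) (hn : 1 ≤ n) :
    expectedDistinctParts n - Real.logb 2 n
          - Real.eulerMascheroniConstant / Real.log 2 + 3 / 2
          - g (Real.logb 2 n) =
      (∑' j : ℕ, Real.exp (-(n * (2:ℝ)^j))) + Real.exp (-((n:ℝ) * (1/2)))
        - ∑' j : ℕ, (uu (j+1) n - Real.exp (-(n * (1/2^((j+1)+1))))) := by
  have hS1 : ∀ j : ℕ, Real.exp (-(2:ℝ) ^ (Real.logb 2 n + j)) = Real.exp (-(n * (2:ℝ)^j)) := by
    intro j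
    rw [pow_logb_add n hn, Real.rpow_natCast]
  have hS2 : ∀ j : ℕ, 1 - Real.exp (-(2:ℝ) ^ (Real.logb 2 n - (j+1))) =
      1 - Real.exp (-(n * (1/2^(j+1)))) := by
    intro j
    rw [sub_eq_add_neg (Real.logb 2 n), pow_logb_add n hn, Real.rpow_neg (by norm_num), one_div]
    congr 5
    exact_mod_cast Real.rpow_natCast 2 (j+1)
  have hz : ∀ k ∉ Finset.range n, 1 - uu (k+1) n = 0 := by
    intro k hk
    simp at hk
    rw [uu_lt (k+1) n hn (by omega)]; ring
  have hE : HasSum (fun k => 1 - uu (k+1) n) (expectedDistinctParts n) := by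
    rw [expected_eq n hn]
    exact hasSum_sum_of_ne_finset_zero hz
  have hX := exp_summable n (Nat.cast_nonneg n) 1
  have hX2 := exp_summable n (Nat.cast_nonneg n) 2
  have hsub : ∑' j : ℕ, (uu (j+1) n - Real.exp (-(n * (1/2^((j+1)+1))))) =
      (∑' j : ℕ, (1 - Real.exp (-((n:ℝ) * (1/2^(j+2)))))) - expectedDistinctParts n := by
    rw [← hE.tsum_eq, ← hX2.tsum_sub hE.summable]
    refine tsum_congr fun j => ?_
    ring
  have hshift := hX.tsum_eq_zero_add
  unfold g
  simp_rw [hS1, hS2]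
  rw [hsub, hshift]
  simp only [zero_add, pow_one, add_assoc, one_add_one_eq_two]
  ring

lemma tendsto_exp_mul (c : ℝ) (hc : 0 < c) :
    Tendsto (fun n : ℕ => Real.exp (-((n:ℝ) * c))) atTop (nhds 0) := by
  refine Real.tendsto_exp_neg_atTop_nhds_zero.comp ?_
  exact tendsto_natCast_atTop_atTop.atTop_mul_const hc

theorem expectedDistinctParts_asymptotics :
    Tendsto (fun n : ℕ =>
        expectedDistinctParts n - Real.logb 2 n
          - Real.eulerMascheroniConstant / Real.log 2 + 3 / 2
          - g (Real.logb 2 n))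
      atTop (nhds 0) := by
  have hA : Tendsto (fun n : ℕ => ∑' j : ℕ, Real.exp (-(n * (2:ℝ)^j))) atTop
      (nhds (∑' j : ℕ, (0:ℝ))) := by
    refine tendsto_tsum_of_dominated_convergence (bound := fun j : ℕ => Real.exp (-(j:ℝ)))
      Real.summable_exp_neg_nat (fun j => tendsto_exp_mul _ (by positivity)) ?_
    filter_upwards [eventually_ge_atTop 1] with n hn j
    rw [Real.norm_eq_abs, abs_of_pos (Real.exp_pos _)]
    apply Real.exp_le_exp.2
    have h1 : (1:ℝ) ≤ n := by exact_mod_cast hn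
    have h2 : (j:ℝ) ≤ 2 ^ j := by exact_mod_cast Nat.lt_two_pow_self.le
    have h3 : (0:ℝ) < 2 ^ j := by positivity
    nlinarith
  have hB : Tendsto (fun n : ℕ =>
      ∑' j : ℕ, (uu (j+1) n - Real.exp (-(n * (1/2^((j+1)+1)))))) atTop
      (nhds (∑' j : ℕ, (0:ℝ))) := by
    refine tendsto_tsum_of_dominated_convergence summable_bd ?_ ?_
    · intro j
      simpa using (uu_tendsto (j+1) (by omega)).sub
        (tendsto_exp_mul (1/2^((j+1)+1)) (by positivity))
    · filter_upwards [eventually_ge_atTop 1] with n hn j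
      exact uu_exp_bound' (j+1) n (by omega) hn
  have hC := (hA.add (tendsto_exp_mul (1/2) (by norm_num))).sub hB
  simp only [tsum_zero, add_zero, sub_zero] at hC
  refine hC.congr' ?_
  filter_upwards [eventually_ge_atTop 1] with n hn
  exact (final_eq n hn).symm
end

section
/- The function g defined by g(x) = −x − γ/ln 2 + 1/2 − ∑_{m=−∞}^{0} exp(−2^{x−m}) + ∑_{m=1}^{∞} (1 − exp(−2^{x−m})) is nonconstant and satisfies |g(x)| ≤ 0.0000016 for every real x. -/
open Real

section helpers
open Real Filter Topology MeasureTheory Set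

noncomputable def ff (t : ℝ) : ℝ := Real.log 2 * (2 : ℝ) ^ t * Real.exp (-(2 : ℝ) ^ t)

lemma hasDerivAt_E (c x : ℝ) :
    HasDerivAt (fun x : ℝ => Real.exp (-(2 : ℝ) ^ (x + c))) (-(ff (x + c))) x := by
  have h1 : HasDerivAt (fun x : ℝ => (2 : ℝ) ^ (x + c)) (Real.log 2 * (2 : ℝ) ^ (x + c)) x := by
    have := ((hasDerivAt_id x).add_const c).const_rpow (a := 2) (by norm_num)
    simpa using this
  have := h1.neg.exp
  refine this.congr_deriv ?_
  simp only [ff, Pi.neg_apply]; ring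

lemma ff_continuous : Continuous ff := by
  unfold ff
  have : Continuous fun t : ℝ => (2 : ℝ) ^ t := Real.continuous_const_rpow (by norm_num)
  fun_prop

lemma ff_nonneg (t : ℝ) : 0 ≤ ff t := by
  unfold ff
  have := Real.log_pos (by norm_num : (1 : ℝ) < 2)
  positivity

lemma ff_le (t : ℝ) : ff t ≤ 2 * (2 : ℝ) ^ (-|t|) := by
  unfold ff
  have hl := Real.log_pos (by norm_num : (1 : ℝ) < 2)
  have hl2 : Real.log 2 ≤ 1 := by linarith [Real.log_two_lt_d9]
  have hu : 0 < (2 : ℝ) ^ t := by positivity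
  rcases le_total 0 t with h | h
  · rw [abs_of_nonneg h, Real.rpow_neg (by norm_num)]
    set u := (2 : ℝ) ^ t
    have h2 := Real.quadratic_le_exp_of_nonneg hu.le
    rw [Real.exp_neg]
    have : u * (Real.exp u)⁻¹ ≤ 2 * u⁻¹ := by
      rw [← div_eq_mul_inv, ← div_eq_mul_inv, div_le_div_iff₀ (Real.exp_pos _) hu]
      nlinarith
    have h3 : 0 ≤ u * (Real.exp u)⁻¹ := by positivity
    nlinarith
  · rw [abs_of_nonpos h, neg_neg]
    set u := (2 : ℝ) ^ t
    have h1 : Real.exp (-u) ≤ 1 := Real.exp_le_one_iff.2 (by linarith)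
    have h4 := Real.exp_pos (-u)
    have : Real.log 2 * u ≤ u := by nlinarith
    calc Real.log 2 * u * Real.exp (-u) ≤ u * 1 := by gcongr
      _ ≤ 2 * u := by linarith

lemma ff_le' {R x : ℝ} (hx : |x| ≤ R) (n : ℝ) :
    ff (x + n) ≤ 2 * (2 : ℝ) ^ R * (2 : ℝ) ^ (-|n|) := by
  refine (ff_le _).trans ?_
  rw [mul_assoc, ← Real.rpow_add (by norm_num)]
  gcongr
  · norm_num
  · have : |n| ≤ |x + n| + |x| := by
      have := abs_sub (x + n) x
      simpa using this
    linarith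

lemma two_rpow_neg_nat (n : ℕ) : (2 : ℝ) ^ (-(n : ℝ)) = (1 / 2) ^ n := by
  rw [Real.rpow_neg (by norm_num), Real.rpow_natCast]; simp

lemma summable_two_nat : Summable fun n : ℕ => (2 : ℝ) ^ (-(n : ℝ)) := by
  simp_rw [two_rpow_neg_nat]
  exact summable_geometric_two

lemma summable_two_int : Summable fun n : ℤ => (2 : ℝ) ^ (-|(n : ℝ)|) := by
  refine Summable.of_nat_of_neg ?_ ?_
  · simpa using summable_two_nat
  · simpa using summable_two_nat

lemma summable_ff (x : ℝ) : Summable fun n : ℤ => ff (x + n) := 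
  Summable.of_nonneg_of_le (fun _ => ff_nonneg _) (fun n => ff_le' le_rfl n)
    (summable_two_int.mul_left _)

lemma E_le (t : ℝ) : Real.exp (-(2 : ℝ) ^ t) ≤ (2 : ℝ) ^ (-t) := by
  have hu : 0 < (2 : ℝ) ^ t := by positivity
  rw [Real.exp_neg, Real.rpow_neg (by norm_num)]
  gcongr
  linarith [Real.add_one_le_exp ((2 : ℝ) ^ t)]

lemma E_ge (t : ℝ) : 1 - Real.exp (-(2 : ℝ) ^ t) ≤ (2 : ℝ) ^ t := by
  linarith [Real.add_one_le_exp (-(2 : ℝ) ^ t)]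

lemma E_le_one (t : ℝ) : 0 ≤ 1 - Real.exp (-(2 : ℝ) ^ t) := by
  have hu : 0 < (2 : ℝ) ^ t := by positivity
  have : Real.exp (-(2 : ℝ) ^ t) ≤ 1 := Real.exp_le_one_iff.2 (by linarith)
  linarith

lemma hasDerivAt_S1 (x : ℝ) :
    HasDerivAt (fun x : ℝ => ∑' j : ℕ, Real.exp (-(2 : ℝ) ^ (x + j))) (∑' j : ℕ, -ff (x + j)) x := by
  set R := |x| + 1
  have hR : 0 < R := by positivity
  refine hasDerivAt_tsum_of_isPreconnected (t := Metric.ball 0 R) (y₀ := (0 : ℝ))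
    (u := fun j : ℕ => 2 * (2 : ℝ) ^ R * (2 : ℝ) ^ (-|(j : ℝ)|)) ?_ Metric.isOpen_ball
    (convex_ball _ _).isPreconnected (fun n y _ => hasDerivAt_E _ _) ?_ (by simpa) ?_ ?_
  · simpa using summable_two_nat.mul_left _
  · intro n y hy
    rw [norm_neg, Real.norm_of_nonneg (ff_nonneg _)]
    refine ff_le' ?_ _
    simp at hy; exact hy.le
  · refine Summable.of_nonneg_of_le (fun _ => (Real.exp_pos _).le) (fun n => E_le _) ?_
    simpa using summable_two_nat
  · simp [R]

lemma hasDerivAt_S2 (x : ℝ) :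
    HasDerivAt (fun x : ℝ => ∑' j : ℕ, (1 - Real.exp (-(2 : ℝ) ^ (x - (j + 1)))))
      (∑' j : ℕ, ff (x - (j + 1))) x := by
  set R := |x| + 1
  have hR : 0 < R := by positivity
  have hs : Summable fun j : ℕ => (2 : ℝ) ^ (-((j : ℝ) + 1)) := by
    simpa only [Nat.cast_add, Nat.cast_one] using (summable_nat_add_iff 1).2 summable_two_nat
  refine hasDerivAt_tsum_of_isPreconnected
    (g := fun (j : ℕ) (x : ℝ) => 1 - Real.exp (-(2 : ℝ) ^ (x - ((j : ℝ) + 1))))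
    (g' := fun (j : ℕ) (x : ℝ) => ff (x - ((j : ℝ) + 1))) (t := Metric.ball 0 R) (y₀ := (0 : ℝ))
    (u := fun j : ℕ => 2 * (2 : ℝ) ^ R * (2 : ℝ) ^ (-|-((j : ℝ) + 1)|)) ?_ Metric.isOpen_ball
    (convex_ball _ _).isPreconnected (fun n y _ => ?_) ?_ (by simpa using hR) ?_ ?_
  · refine Summable.mul_left _ ?_
    refine hs.congr fun j => ?_
    rw [abs_neg, abs_of_pos (by positivity)]
  · have := (hasDerivAt_E (-((n : ℝ) + 1)) y).const_sub 1
    simpa [sub_eq_add_neg] using this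
  · intro n y hy
    rw [Real.norm_of_nonneg (ff_nonneg _)]
    refine ff_le' ?_ _
    simp at hy; exact hy.le
  · refine Summable.of_nonneg_of_le (fun _ => E_le_one _) (fun n => E_ge _) ?_
    simpa only [zero_sub] using hs
  · simp [R]

lemma hasDerivAt_g (x : ℝ) : HasDerivAt g (-1 + ∑' n : ℤ, ff (x + n)) x := by
  have h := (((((hasDerivAt_id' x).fun_neg.sub_const
    (Real.eulerMascheroniConstant / Real.log 2)).add_const (1 / 2 : ℝ)).fun_sub
    (hasDerivAt_S1 x)).fun_add (hasDerivAt_S2 x))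
  have hg : g = fun x : ℝ => -x - Real.eulerMascheroniConstant / Real.log 2 + 1 / 2
    - ∑' j : ℕ, Real.exp (-(2 : ℝ) ^ (x + j))
    + ∑' j : ℕ, (1 - Real.exp (-(2 : ℝ) ^ (x - (j + 1)))) := rfl
  rw [hg]
  refine h.congr_deriv ?_
  have h1 : Summable fun j : ℕ => ff (x + ((j : ℤ) : ℝ)) :=
    (summable_ff x).comp_injective Nat.cast_injective
  have h2 : Summable fun j : ℕ => ff (x + ((-((j : ℤ) + 1) : ℤ) : ℝ)) :=
    (summable_ff x).comp_injective (i := fun j : ℕ => (-((j : ℤ) + 1) : ℤ))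
      (fun a b h => by simpa using h)
  have h3 : ∑' n : ℤ, ff (x + n) = ∑' j : ℕ, ff (x + ((j : ℤ) : ℝ))
      + ∑' j : ℕ, ff (x + ((-((j : ℤ) + 1) : ℤ) : ℝ)) :=
    (HasSum.of_nat_of_neg_add_one (f := fun n : ℤ => ff (x + n)) h1.hasSum h2.hasSum).tsum_eq
  have h4 : ∀ j : ℕ, ff (x + ((-((j : ℤ) + 1) : ℤ) : ℝ)) = ff (x - ((j : ℝ) + 1)) := fun j => by
    push_cast; rw [sub_eq_add_neg]
  simp_rw [h4, Int.cast_natCast] at h3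
  rw [h3, tsum_neg]
  ring


noncomputable def T : ℝ := 2 * π ^ 2 / Real.log 2

lemma norm_Gamma_sq (y : ℝ) (hy : y ≠ 0) :
    ‖Complex.Gamma (1 - y * Complex.I)‖ ^ 2 = π * y / Real.sinh (π * y) := by
  have h1 := Complex.Gamma_mul_Gamma_one_sub (y * Complex.I)
  have hyI : (y * Complex.I : ℂ) ≠ 0 := by simp [hy]
  have h2 := Complex.Gamma_add_one (y * Complex.I) hyI
  have h3 : Complex.Gamma (y * Complex.I + 1)
      = (starRingEnd ℂ) (Complex.Gamma (1 - y * Complex.I)) := by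
    rw [← Complex.Gamma_conj]; congr 1; simp; ring
  have h4 : (starRingEnd ℂ) (Complex.Gamma (1 - y * Complex.I)) * Complex.Gamma (1 - y * Complex.I)
      = y * Complex.I * (π / Complex.sin (π * (y * Complex.I))) := by
    rw [← h1, ← h3, h2]; ring
  rw [Complex.conj_mul', ← mul_assoc, Complex.sin_mul_I] at h4
  have hs : Real.sinh (π * y) ≠ 0 := by
    rw [Ne, Real.sinh_eq_zero]; simp [hy, Real.pi_ne_zero]
  have : ((‖Complex.Gamma (1 - y * Complex.I)‖ ^ 2 : ℝ) : ℂ) = ((π * y / Real.sinh (π * y) : ℝ) : ℂ) := by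
    push_cast
    rw [h4]
    have : Complex.sinh (π * y) ≠ 0 := by exact_mod_cast hs
    field_simp
  exact_mod_cast this

/-- `a k` is the `k`-th Fourier coefficient. -/
noncomputable def aa (k : ℤ) : ℂ := Complex.Gamma (1 - ((2 * π * k / Real.log 2 : ℝ) : ℂ) * Complex.I)

lemma aa_zero : aa 0 = 1 := by simp [aa]

lemma aa_ne_zero (k : ℤ) : aa k ≠ 0 := by
  refine Complex.Gamma_ne_zero_of_re_pos ?_
  rw [Complex.sub_re, Complex.re_ofReal_mul]
  simp

lemma T_gt : 28.47 < T := by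
  unfold T
  have h1 := Real.pi_gt_d6
  have h2 := Real.log_two_lt_d9
  have h3 := Real.log_two_gt_d9
  rw [lt_div_iff₀ (by linarith)]
  nlinarith

lemma T_lt : T < 28.48 := by
  unfold T
  have h1 := Real.pi_lt_d6
  have h1 := Real.pi_gt_d6
  have h2 := Real.log_two_lt_d9
  have h3 := Real.log_two_gt_d9
  rw [div_lt_iff₀ (by linarith)]
  nlinarith

lemma norm_aa_sq (k : ℤ) (hk : k ≠ 0) : ‖aa k‖ ^ 2 = (k * T) / Real.sinh (k * T) := by
  have hl := Real.log_pos (by norm_num : (1 : ℝ) < 2)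
  unfold aa
  rw [norm_Gamma_sq]
  · have : π * (2 * π * k / Real.log 2) = k * T := by unfold T; field_simp
    rw [this]
  · have : (k : ℝ) ≠ 0 := by exact_mod_cast hk
    have := Real.pi_ne_zero
    positivity

lemma norm_aa_neg (k : ℤ) : ‖aa (-k)‖ = ‖aa k‖ := by
  rw [← Complex.norm_conj (aa k)]
  unfold aa
  rw [← Complex.Gamma_conj]
  congr 2
  rw [map_sub, map_mul, Complex.conj_ofReal, Complex.conj_I, map_one]
  push_cast; ring

lemma sinh_T_gt : (1155000000000 : ℝ) < Real.sinh T := by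
  have h0 : Real.sinh 28.47 < Real.sinh T := Real.sinh_lt_sinh.2 T_gt
  refine lt_of_le_of_lt ?_ h0
  rw [Real.sinh_eq]
  have h1 : Real.exp (-28.47) ≤ 1 := Real.exp_le_one_iff.2 (by norm_num)
  have h2 : (2312000000000 : ℝ) ≤ Real.exp 28.47 := by
    have e1 := Real.exp_one_gt_d9
    have : Real.exp 28.47 = Real.exp 1 ^ 28 * Real.exp 0.47 := by
      rw [← Real.exp_nat_mul, ← Real.exp_add]; norm_num
    rw [this]
    have e2 : (1.5999 : ℝ) ≤ Real.exp 0.47 := by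
      refine le_trans ?_ (Real.sum_le_exp_of_nonneg (by norm_num) 7)
      norm_num [Finset.sum_range_succ, Nat.factorial]
    calc (2312000000000 : ℝ) ≤ 2.718281828 ^ 28 * 1.5999 := by norm_num
      _ ≤ _ := by gcongr; linarith
  linarith

lemma norm_aa_succ (k : ℕ) : ‖aa ((k : ℤ) + 1 + 1)‖ ≤ 0.00001 * ‖aa ((k : ℤ) + 1)‖ := by
  have hT : 0 < T := by linarith [T_gt]
  have hs := sinh_T_gt
  rw [← sq_le_sq₀ (norm_nonneg _) (by positivity), mul_pow, norm_aa_sq _ (by positivity),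
    norm_aa_sq _ (by positivity)]
  push_cast
  set u : ℝ := (k + 1) * T with hu
  have hu0 : 0 < u := by positivity
  have hsu : 0 < Real.sinh u := Real.sinh_pos_iff.2 hu0
  have h1 : ((k : ℝ) + 1 + 1) * T = u + T := by rw [hu]; ring
  have h2 : u + T ≤ 2 * u := by
    rw [hu]; nlinarith [(Nat.cast_nonneg k : (0 : ℝ) ≤ k)]
  rw [h1, Real.sinh_add]
  have h3 : Real.sinh T < Real.cosh T := Real.sinh_lt_cosh T
  have h4 : 0 < Real.cosh u := Real.cosh_pos u
  have h5 : 1000000000000 * Real.sinh u ≤ Real.sinh u * Real.cosh T + Real.cosh u * Real.sinh T := by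
    have : 0 < Real.sinh T := by linarith
    have := mul_pos h4 this
    nlinarith
  calc (u + T) / (Real.sinh u * Real.cosh T + Real.cosh u * Real.sinh T)
      ≤ (2 * u) / (1000000000000 * Real.sinh u) := by gcongr
    _ = (2 / 10 ^ 12) * (u / Real.sinh u) := by field_simp; norm_num
    _ ≤ _ := by gcongr; norm_num

lemma norm_aa_one : ‖aa 1‖ ≤ 0.00000497 := by
  have hT : 0 < T := by linarith [T_gt]
  rw [← sq_le_sq₀ (norm_nonneg _) (by positivity), norm_aa_sq _ (by norm_num)]
  simp only [Int.cast_one, one_mul]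
  rw [div_le_iff₀ (by linarith [sinh_T_gt])]
  have := T_lt
  have := sinh_T_gt
  norm_num at *
  linarith

lemma norm_aa_nat (k : ℕ) : ‖aa ((k : ℤ) + 1)‖ ≤ 0.00000497 * (0.00001) ^ k := by
  induction k with
  | zero => simpa using norm_aa_one
  | succ k ih =>
    push_cast
    refine (norm_aa_succ k).trans ?_
    rw [pow_succ]
    nlinarith

lemma summable_aa : Summable fun k : ℤ => ‖aa k‖ := by
  have hs : Summable fun k : ℕ => (0.00000497 * (0.00001) ^ k : ℝ) :=
    (summable_geometric_of_lt_one (by norm_num) (by norm_num)).mul_left _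
  have h1 : Summable fun k : ℕ => ‖aa ((k : ℤ) + 1)‖ :=
    hs.of_nonneg_of_le (fun _ => norm_nonneg _) norm_aa_nat
  refine Summable.of_nat_of_neg_add_one ?_ ?_
  · exact (summable_nat_add_iff 1).1 (by simpa using h1)
  · simpa only [norm_aa_neg] using h1


lemma cov {F : Type*} [NormedAddCommGroup F] [NormedSpace ℝ F] (h : ℝ → F) :
    ∫ u in Ioi (0 : ℝ), h u = ∫ t : ℝ, (Real.log 2 * (2 : ℝ) ^ t) • h ((2 : ℝ) ^ t) := by
  have hl := Real.log_pos (by norm_num : (1 : ℝ) < 2)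
  have him : (fun t : ℝ => (2 : ℝ) ^ t) '' univ = Ioi 0 := by
    ext u
    simp only [image_univ, mem_range, mem_Ioi]
    constructor
    · rintro ⟨t, rfl⟩; positivity
    · intro hu
      exact ⟨Real.logb 2 u, Real.rpow_logb (by norm_num) (by norm_num) hu⟩
  rw [← him, integral_image_eq_integral_abs_deriv_smul (f' := fun t => Real.log 2 * (2 : ℝ) ^ t)
    MeasurableSet.univ]
  · simp only [Measure.restrict_univ]
    congr 1; ext t
    rw [abs_of_pos (by positivity)]
  · intro x _
    have := (hasDerivAt_id x).const_rpow (a := 2) (by norm_num)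
    exact (by simpa using this : HasDerivAt (fun t : ℝ => (2 : ℝ) ^ t) _ x).hasDerivWithinAt
  · intro a _ b _ hab
    exact (Real.rpow_right_inj (by norm_num) (by norm_num)).1 hab

noncomputable def FF : C(ℝ, ℂ) := ⟨fun t => (ff t : ℂ), Complex.continuous_ofReal.comp ff_continuous⟩

open FourierTransform in
lemma fourier_FF (m : ℤ) : 𝓕 (FF : ℝ → ℂ) m = aa m := by
  have hl := Real.log_pos (by norm_num : (1 : ℝ) < 2)
  rw [Real.fourier_real_eq_integral_exp_smul]
  unfold aa
  rw [Complex.Gamma_eq_integral, Complex.GammaIntegral, cov]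
  · congr 1; ext t
    have hu : (0 : ℝ) < (2 : ℝ) ^ t := by positivity
    rw [Complex.cpow_def_of_ne_zero (by exact_mod_cast hu.ne'), ← Complex.ofReal_log hu.le,
      Real.log_rpow (by norm_num)]
    have : ((t * Real.log 2 : ℝ) : ℂ) * (1 - ((2 * π * m / Real.log 2 : ℝ) : ℂ) * Complex.I - 1)
      = ((-2 * π * t * m : ℝ) : ℂ) * Complex.I := by
      have : (t * Real.log 2) * (2 * π * m / Real.log 2) = 2 * π * t * m := by field_simp
      have h2 : ((t * Real.log 2 : ℝ) : ℂ) * ((2 * π * m / Real.log 2 : ℝ) : ℂ)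
        = ((2 * π * t * m : ℝ) : ℂ) := by rw [← this]; push_cast; ring
      rw [show (-2 * π * t * m : ℝ) = -(2 * π * t * m) by ring, Complex.ofReal_neg, ← h2]
      ring
    rw [this]
    simp only [FF, ff, ContinuousMap.coe_mk, smul_eq_mul, Complex.real_smul]
    push_cast
    ring
  · rw [Complex.sub_re, Complex.re_ofReal_mul]
    simp

lemma norm_FF (K : TopologicalSpace.Compacts ℝ) :
    Summable fun n : ℤ => ‖(FF.comp (ContinuousMap.addRight (n : ℝ))).restrict K‖ := by
  obtain ⟨R, hR⟩ := K.isCompact.isBounded.exists_norm_le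
  refine Summable.of_nonneg_of_le (fun _ => norm_nonneg _) (fun n => ?_)
    (summable_two_int.mul_left (2 * (2 : ℝ) ^ R))
  rw [ContinuousMap.norm_le _ (by positivity)]
  rintro ⟨x, hx⟩
  have := ff_le' (hR x hx) n
  have h2 : ‖((ff (x + n) : ℝ) : ℂ)‖ = ff (x + n) := by
    rw [Complex.norm_real, Real.norm_of_nonneg (ff_nonneg _)]
  rw [← h2] at this
  exact this

lemma poisson (x : ℝ) :
    ((∑' n : ℤ, ff (x + n) : ℝ) : ℂ) = ∑' n : ℤ, aa n * fourier n (x : UnitAddCircle) := by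
  have h := Real.tsum_eq_tsum_fourier norm_FF (by
    simp_rw [fourier_FF]
    exact summable_aa.of_norm) x
  simp_rw [fourier_FF] at h
  rw [← h, Complex.ofReal_tsum]
  rfl

theorem g_nonconst : ¬ ∃ c : ℝ, ∀ x : ℝ, g x = c := by
  rintro ⟨c, hc⟩
  have hF : ∀ x : ℝ, ∑' n : ℤ, ff (x + n) = 1 := by
    intro x
    have h1 := hasDerivAt_g x
    have h2 : g = fun _ => c := funext hc
    rw [h2] at h1
    have := h1.unique (hasDerivAt_const x c)
    linarith
  have h := Real.fourierCoeff_tsum_comp_add norm_FF 1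
  have h3 : (Function.Periodic.lift (FF.periodic_tsum_comp_add_zsmul 1) : UnitAddCircle → ℂ)
      = fourier 0 := by
    ext y
    induction y using QuotientAddGroup.induction_on with
    | H x =>
      refine (Function.Periodic.lift_coe _ x).trans ?_
      have hs : Summable fun n : ℤ => FF.comp (ContinuousMap.addRight (n • (1 : ℝ))) := by
        refine ContinuousMap.summable_of_locally_summable_norm fun K => ?_
        simpa using norm_FF K
      rw [← ContinuousMap.tsum_apply hs]
      have := congrArg (fun z : ℝ => (z : ℂ)) (hF x)
      simp only [Complex.ofReal_tsum] at this
      simpa [FF] using this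
  rw [h3, fourier_FF, fourierCoeff_fourier] at h
  have h4 := aa_ne_zero 1
  rw [← h] at h4
  simp at h4

lemma integral_t_ff : ∫ t : ℝ, t * ff t = -Real.eulerMascheroniConstant / Real.log 2 := by
  have hl := Real.log_pos (by norm_num : (1 : ℝ) < 2)
  have h1 := Complex.hasDerivAt_GammaIntegral (s := 1) (by simp)
  have h2 : Complex.GammaIntegral =ᶠ[𝓝 1] Complex.Gamma := by
    have : ∀ᶠ s : ℂ in 𝓝 1, 0 < s.re :=
      (isOpen_lt continuous_const Complex.continuous_re).mem_nhds (by simp)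
    filter_upwards [this] with s hs
    exact (Complex.Gamma_eq_integral hs).symm
  have h3 := (h1.congr_of_eventuallyEq h2.symm).unique Complex.hasDerivAt_Gamma_one
  rw [cov] at h3
  have h4 : ((∫ t : ℝ, Real.log 2 * (t * ff t) : ℝ) : ℂ) = ((-Real.eulerMascheroniConstant : ℝ) : ℂ) := by
    rw [← integral_complex_ofReal]
    push_cast
    rw [← h3]
    congr 1; ext t
    rw [Real.log_rpow (by norm_num)]
    simp only [ff, sub_self, Complex.cpow_zero, Complex.real_smul]
    push_cast
    ring
  have h5 : ∫ t : ℝ, Real.log 2 * (t * ff t) = -Real.eulerMascheroniConstant := by exact_mod_cast h4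
  rw [integral_const_mul] at h5
  rw [eq_div_iff hl.ne', ← h5]; ring

lemma integrable_t_ff : Integrable fun t : ℝ => t * ff t := by
  by_contra h
  have := integral_undef h
  rw [integral_t_ff] at this
  have hl := Real.log_pos (by norm_num : (1 : ℝ) < 2)
  have h2 := Real.one_half_lt_eulerMascheroniConstant
  rw [div_eq_zero_iff] at this
  rcases this with h | h <;> linarith


lemma hasSum_int {ι E : Type*} [Countable ι] [NormedAddCommGroup E] [NormedSpace ℝ E]
    [CompleteSpace E]
    (f : ι → ℝ → E) (hf : ∀ i, Continuous (f i)) (u : ι → ℝ) (hu : Summable u)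
    (hb : ∀ i, ∀ x ∈ Icc (0 : ℝ) 1, ‖f i x‖ ≤ u i) :
    HasSum (fun i => ∫ x in (0 : ℝ)..1, f i x) (∫ x in (0 : ℝ)..1, ∑' i, f i x) := by
  refine intervalIntegral.hasSum_integral_of_dominated_convergence (fun i _ => u i)
    (fun i => (hf i).aestronglyMeasurable) ?_ ?_ ?_ ?_
  · intro i
    refine Eventually.of_forall fun x hx => hb i x ?_
    rw [uIoc_of_le zero_le_one] at hx
    exact ⟨hx.1.le, hx.2⟩
  · exact Eventually.of_forall fun x _ => hu
  · exact intervalIntegrable_const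
  · refine Eventually.of_forall fun x hx => ?_
    rw [uIoc_of_le zero_le_one] at hx
    exact (Summable.of_norm_bounded hu fun i => hb i x ⟨hx.1.le, hx.2⟩).hasSum

noncomputable def EE (t : ℝ) : ℝ := Real.exp (-(2 : ℝ) ^ t)

lemma EE_continuous : Continuous EE := by
  unfold EE
  have : Continuous fun t : ℝ => (2 : ℝ) ^ t := Real.continuous_const_rpow (by norm_num)
  fun_prop

lemma tendsto_A : Tendsto (fun N : ℕ => ∫ t in (0 : ℝ)..N, EE t) atTop
    (𝓝 (∫ x in (0 : ℝ)..1, ∑' j : ℕ, EE (x + j))) := by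
  have h := (hasSum_int (fun (j : ℕ) (x : ℝ) => EE (x + j))
    (fun j => EE_continuous.comp (continuous_id.add continuous_const))
    (fun j => (2 : ℝ) ^ (-(j : ℝ))) summable_two_nat (by
      intro j x hx
      rw [Real.norm_of_nonneg (show 0 ≤ EE (x + j) from (Real.exp_pos _).le)]
      refine (E_le _).trans ?_
      gcongr
      · norm_num
      · linarith [hx.1])).tendsto_sum_nat
  refine h.congr fun N => ?_
  have : ∀ j : ℕ, ∫ x in (0 : ℝ)..1, EE (x + j) = ∫ t in ((j : ℕ) : ℝ)..((j + 1 : ℕ) : ℝ), EE t := by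
    intro j
    rw [intervalIntegral.integral_comp_add_right]
    congr 1
    · simp
    · push_cast; ring
  simp_rw [this]
  rw [intervalIntegral.sum_integral_adjacent_intervals (a := fun j : ℕ => (j : ℝ))]
  · simp
  · intro k _
    exact EE_continuous.intervalIntegrable _ _

lemma tendsto_B : Tendsto (fun N : ℕ => (N : ℝ) - ∫ t in (-(N : ℝ))..0, EE t) atTop
    (𝓝 (∫ x in (0 : ℝ)..1, ∑' j : ℕ, (1 - EE (x - (j + 1))))) := by
  have h := (hasSum_int (fun (j : ℕ) (x : ℝ) => 1 - EE (x - (j + 1)))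
    (fun j => continuous_const.sub (EE_continuous.comp (continuous_id.sub continuous_const)))
    (fun j => (2 : ℝ) ^ (-(j : ℝ))) summable_two_nat (by
      intro j x hx
      rw [Real.norm_of_nonneg (show 0 ≤ 1 - EE (x - (j + 1)) from E_le_one _)]
      refine (E_ge _).trans ?_
      gcongr
      · norm_num
      · linarith [hx.2])).tendsto_sum_nat
  refine h.congr fun N => ?_
  have hi : ∀ a b : ℝ, IntervalIntegrable EE volume a b := fun a b =>
    EE_continuous.intervalIntegrable _ _
  induction N with
  | zero => simp
  | succ N ih =>
    rw [Finset.sum_range_succ, ih, intervalIntegral.integral_sub, intervalIntegral.integral_comp_sub_right,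
      ← intervalIntegral.integral_add_adjacent_intervals (hi (-((N + 1 : ℕ) : ℝ)) (-(N : ℝ))) (hi (-(N : ℝ)) 0)]
    · simp only [intervalIntegral.integral_const]
      push_cast
      rw [show (0 : ℝ) - (N + 1) = -(N + 1) by ring, show (1 : ℝ) - (N + 1) = -N by ring]
      simp
      ring
    · exact intervalIntegrable_const
    · exact (EE_continuous.comp (continuous_id.sub continuous_const)).intervalIntegrable _ _

lemma parts (N : ℝ) : ∫ t in (-N)..N, EE t
    = N * EE N + N * EE (-N) + ∫ t in (-N)..N, t * ff t := by
  have h : ∀ x ∈ uIcc (-N) N, HasDerivAt (fun t : ℝ => t * EE t) (EE x - x * ff x) x := by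
    intro x _
    have h0 := hasDerivAt_E 0 x
    simp only [add_zero] at h0
    have := (hasDerivAt_id' x).fun_mul h0
    refine HasDerivAt.congr_deriv this ?_
    simp only [EE]; ring
  have hc : Continuous fun t : ℝ => t * ff t := continuous_id.mul ff_continuous
  have := intervalIntegral.integral_eq_sub_of_hasDerivAt h
    ((EE_continuous.sub hc).intervalIntegrable _ _)
  rw [intervalIntegral.integral_sub (EE_continuous.intervalIntegrable _ _)
    (hc.intervalIntegrable _ _)] at this
  linarith

lemma mean_aux : - (∫ x in (0 : ℝ)..1, ∑' j : ℕ, EE (x + j))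
    + ∫ x in (0 : ℝ)..1, ∑' j : ℕ, (1 - EE (x - (j + 1))) = Real.eulerMascheroniConstant / Real.log 2 := by
  have h := tendsto_A.neg.add tendsto_B
  refine tendsto_nhds_unique h ?_
  have hz : Tendsto (fun N : ℕ => (N : ℝ) * (1 / 2 : ℝ) ^ N) atTop (𝓝 0) :=
    tendsto_self_mul_const_pow_of_lt_one (by norm_num) (by norm_num)
  have h1 : Tendsto (fun N : ℕ => (N : ℝ) * EE N) atTop (𝓝 0) := by
    refine squeeze_zero (fun N => ?_) (fun N => ?_) hz
    · have := (Real.exp_pos (-(2 : ℝ) ^ (N : ℝ))).le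
      unfold EE; positivity
    · rw [← two_rpow_neg_nat]
      gcongr
      exact E_le _
  have h2 : Tendsto (fun N : ℕ => (N : ℝ) * (1 - EE (-(N : ℝ)))) atTop (𝓝 0) := by
    refine squeeze_zero (fun N => ?_) (fun N => ?_) hz
    · exact mul_nonneg (Nat.cast_nonneg _) (E_le_one _)
    · rw [← two_rpow_neg_nat]
      gcongr
      exact E_ge _
  have h3 : Tendsto (fun N : ℕ => ∫ t in (-(N : ℝ))..N, t * ff t) atTop
      (𝓝 (-Real.eulerMascheroniConstant / Real.log 2)) := by
    rw [← integral_t_ff]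
    exact intervalIntegral_tendsto_integral integrable_t_ff
      (tendsto_neg_atTop_atBot.comp tendsto_natCast_atTop_atTop) tendsto_natCast_atTop_atTop
  have h4 := (h2.sub h1).sub h3
  refine (h4.congr fun N => ?_).trans_eq ?_
  · have h5 := parts N
    have h6 := intervalIntegral.integral_add_adjacent_intervals
      (EE_continuous.intervalIntegrable (μ := volume) (-(N : ℝ)) 0)
      (EE_continuous.intervalIntegrable (μ := volume) 0 (N : ℝ))
    linarith
  · congr 1; ring

lemma mean_g : ∫ x in (0 : ℝ)..1, g x = 0 := by
  have hc1 : Continuous fun x : ℝ => ∑' j : ℕ, EE (x + j) :=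
    continuous_iff_continuousAt.2 fun x => (hasDerivAt_S1 x).continuousAt
  have hc2 : Continuous fun x : ℝ => ∑' j : ℕ, (1 - EE (x - (j + 1))) :=
    continuous_iff_continuousAt.2 fun x => (hasDerivAt_S2 x).continuousAt
  have hg : ∀ x, g x = (-x - Real.eulerMascheroniConstant / Real.log 2 + 1 / 2)
    - (∑' j : ℕ, EE (x + j)) + ∑' j : ℕ, (1 - EE (x - (j + 1))) := fun x => rfl
  have hc0 : Continuous fun x : ℝ => (-x - Real.eulerMascheroniConstant / Real.log 2 + 1 / 2) := by
    fun_prop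
  simp_rw [hg]
  rw [intervalIntegral.integral_add ((hc0.fun_sub hc1).intervalIntegrable _ _)
    (hc2.intervalIntegrable _ _), intervalIntegral.integral_sub (hc0.intervalIntegrable _ _)
    (hc1.intervalIntegrable _ _)]
  have h0 : ∫ x in (0 : ℝ)..1, (-x - Real.eulerMascheroniConstant / Real.log 2 + 1 / 2)
      = - (Real.eulerMascheroniConstant / Real.log 2) := by
    rw [intervalIntegral.integral_add, intervalIntegral.integral_sub, intervalIntegral.integral_neg,
      integral_id]
    · simp; ring
    all_goals exact Continuous.intervalIntegrable (by fun_prop) _ _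
  rw [h0]
  linarith [mean_aux]


noncomputable def bb (k : ℤ) : ℂ := aa k / (2 * π * Complex.I * k)

noncomputable def ee (k : ℤ) (x : ℝ) : ℂ := Complex.exp (2 * π * Complex.I * k * x)

lemma norm_ee (k : ℤ) (x : ℝ) : ‖ee k x‖ = 1 := by
  unfold ee
  rw [show (2 * π * Complex.I * k * x : ℂ) = ((2 * π * k * x : ℝ) : ℂ) * Complex.I by
    push_cast; ring]
  exact Complex.norm_exp_ofReal_mul_I _

lemma hasDerivAt_ee (k : ℤ) (x : ℝ) : HasDerivAt (ee k) (2 * π * Complex.I * k * ee k x) x := by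
  unfold ee
  have h : HasDerivAt (fun x : ℝ => (2 * π * Complex.I * k * x : ℂ)) (2 * π * Complex.I * k) x := by
    have := (Complex.ofRealCLM.hasDerivAt (x := x)).const_mul (2 * π * Complex.I * k : ℂ)
    simpa using this
  refine h.cexp.congr_deriv ?_
  ring

lemma norm_bb (k : ℤ) : ‖bb k‖ = ‖aa k‖ / (2 * π * |(k : ℝ)|) := by
  simp [bb, abs_of_pos Real.pi_pos]

lemma bb_zero : bb 0 = 0 := by simp [bb]

lemma norm_bb_le (k : ℤ) : ‖bb k‖ ≤ ‖aa k‖ / (2 * π) := by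
  rcases eq_or_ne k 0 with rfl | hk
  · rw [bb_zero, norm_zero]; have := Real.pi_pos; positivity
  rw [norm_bb]
  have h1 : (1 : ℝ) ≤ |(k : ℝ)| := by exact_mod_cast Int.one_le_abs hk
  have := Real.pi_pos
  refine div_le_div_of_nonneg_left (norm_nonneg _) (by positivity) ?_
  nlinarith

lemma summable_bb : Summable fun k : ℤ => ‖bb k‖ :=
  (summable_aa.div_const (2 * π)).of_nonneg_of_le (fun _ => norm_nonneg _) norm_bb_le

noncomputable def GG (x : ℝ) : ℂ := ∑' k : ℤ, bb k * ee k x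

lemma hasDerivAt_GG (x : ℝ) : HasDerivAt GG (-1 + ((∑' n : ℤ, ff (x + n) : ℝ) : ℂ)) x := by
  have h := hasDerivAt_tsum (g := fun k x => bb k * ee k x)
    (g' := fun k x => if k = 0 then 0 else aa k * ee k x) (y₀ := (0 : ℝ)) summable_aa
    (fun k y => by
      have h1 := (hasDerivAt_ee k y).const_mul (bb k)
      refine h1.congr_deriv ?_
      split_ifs with hk
      · simp [hk]
      · have : (k : ℂ) ≠ 0 := by exact_mod_cast hk
        have := Real.pi_ne_zero
        unfold bb
        field_simp)
    (fun k y => by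
      split_ifs with hk
      · simp
      · simp [norm_ee])
    (Summable.of_norm (by simpa [norm_ee] using summable_bb)) x
  refine HasDerivAt.congr_deriv (f := GG) h ?_
  rw [poisson]
  have hs : Summable fun n : ℤ => aa n * fourier n (x : UnitAddCircle) := by
    refine Summable.of_norm ?_
    refine summable_aa.congr fun k => ?_
    have : ‖(fourier k (x : UnitAddCircle) : ℂ)‖ = 1 := Circle.norm_coe _
    rw [norm_mul, this, mul_one]
  rw [hs.tsum_eq_add_tsum_ite 0]
  simp only [aa_zero, fourier_zero, mul_one, neg_add_cancel_left]
  refine tsum_congr fun k => ?_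
  rw [fourier_coe_apply]
  simp [ee]

lemma mean_GG : ∫ x in (0 : ℝ)..1, GG x = 0 := by
  have h := hasSum_int (fun k x => bb k * ee k x)
    (fun k => continuous_const.mul (continuous_iff_continuousAt.2
      fun x => (hasDerivAt_ee k x).continuousAt)) (fun k => ‖bb k‖) summable_bb
    (fun k x _ => by simp [norm_ee])
  refine h.unique ?_
  convert hasSum_zero using 2 with k
  rcases eq_or_ne k 0 with rfl | hk
  · simp [bb_zero]
  · rw [intervalIntegral.integral_const_mul]
    unfold ee
    have : (k : ℂ) ≠ 0 := by exact_mod_cast hk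
    rw [integral_exp_mul_complex (by simp [hk, Real.pi_ne_zero])]
    have h2 : Complex.exp (2 * π * Complex.I * k) = 1 := by
      rw [mul_comm]; exact Complex.exp_int_mul_two_pi_mul_I k
    simp [h2]

lemma g_eq_GG (x : ℝ) : (g x : ℂ) = GG x := by
  have hd : ∀ x, HasDerivAt (fun x => (g x : ℂ) - GG x) 0 x := by
    intro x
    have h := ((hasDerivAt_g x).ofReal_comp).fun_sub (hasDerivAt_GG x)
    refine h.congr_deriv ?_
    push_cast; ring
  have hconst : ∀ x y, (g x : ℂ) - GG x = (g y : ℂ) - GG y :=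
    is_const_of_deriv_eq_zero (fun x => (hd x).differentiableAt) (fun x => (hd x).deriv)
  have hcg : Continuous fun x => (g x : ℂ) :=
    continuous_iff_continuousAt.2 fun x => ((hasDerivAt_g x).ofReal_comp).continuousAt
  have hcG : Continuous GG :=
    continuous_iff_continuousAt.2 fun x => (hasDerivAt_GG x).continuousAt
  have h0 : ∫ y in (0 : ℝ)..1, ((g y : ℂ) - GG y) = 0 := by
    rw [intervalIntegral.integral_sub (hcg.intervalIntegrable _ _) (hcG.intervalIntegrable _ _),
      mean_GG, intervalIntegral.integral_ofReal, mean_g]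
    simp
  have h1 : ∫ y in (0 : ℝ)..1, ((g y : ℂ) - GG y) = (g x : ℂ) - GG x := by
    rw [intervalIntegral.integral_congr (g := fun _ => (g x : ℂ) - GG x) (fun y _ => hconst y x)]
    simp
  rw [h0] at h1
  exact (sub_eq_zero.1 h1.symm)

lemma tsum_bb : ∑' k : ℤ, ‖bb k‖ ≤ 0.0000016 := by
  have hpi := Real.pi_gt_d4
  have hs : HasSum (fun k : ℕ => (0.00000497 / (2 * π)) * (0.00001 : ℝ) ^ k)
      ((0.00000497 / (2 * π)) * (1 - 0.00001)⁻¹) :=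
    (hasSum_geometric_of_lt_one (by norm_num) (by norm_num)).mul_left _
  have hle : ∀ k : ℕ, ‖bb ((k : ℤ) + 1)‖ ≤ (0.00000497 / (2 * π)) * (0.00001 : ℝ) ^ k := by
    intro k
    refine (norm_bb_le _).trans ?_
    rw [div_mul_eq_mul_div]
    gcongr
    exact norm_aa_nat k
  have hneg : ∀ k : ℤ, ‖bb (-k)‖ = ‖bb k‖ := fun k => by
    rw [norm_bb, norm_bb, norm_aa_neg]; simp
  have hs1 : Summable fun k : ℕ => ‖bb ((k : ℤ) + 1)‖ :=
    hs.summable.of_nonneg_of_le (fun _ => norm_nonneg _) hle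
  have hs0 : Summable fun k : ℕ => ‖bb (k : ℤ)‖ := (summable_nat_add_iff 1).1 (by simpa using hs1)
  have ht : ∑' k : ℕ, ‖bb ((k : ℤ) + 1)‖ ≤ (0.00000497 / (2 * π)) * (1 - 0.00001)⁻¹ :=
    hasSum_le hle hs1.hasSum hs
  have hs2 : Summable fun k : ℕ => ‖bb (-((k : ℤ) + 1))‖ := by simpa only [hneg] using hs1
  have h3 : ∑' k : ℤ, ‖bb k‖ = ∑' k : ℕ, ‖bb (k : ℤ)‖ + ∑' k : ℕ, ‖bb (-((k : ℤ) + 1))‖ :=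
    (HasSum.of_nat_of_neg_add_one (f := fun k : ℤ => ‖bb k‖) hs0.hasSum hs2.hasSum).tsum_eq
  have h4 : ∑' k : ℕ, ‖bb (k : ℤ)‖ = ∑' k : ℕ, ‖bb ((k : ℤ) + 1)‖ := by
    rw [hs0.tsum_eq_zero_add]
    simp only [Nat.cast_zero, bb_zero, norm_zero, zero_add, Nat.cast_add, Nat.cast_one]
  simp_rw [hneg] at h3
  rw [h3, h4]
  have h2 : (0.00000497 / (2 * π)) * (1 - 0.00001)⁻¹ ≤ (0.0000008 : ℝ) := by
    rw [div_mul_eq_mul_div, div_le_iff₀ (by positivity)]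
    norm_num
    linarith
  linarith

end helpers

theorem g_nonconstant_and_small :
    (¬ ∃ c : ℝ, ∀ x : ℝ, g x = c) ∧ ∀ x : ℝ, |g x| ≤ 0.0000016 := by
  refine ⟨g_nonconst, fun x => ?_⟩
  have h : |g x| = ‖GG x‖ := by rw [← g_eq_GG, Complex.norm_real, Real.norm_eq_abs]
  rw [h]
  refine le_trans ?_ tsum_bb
  unfold GG
  refine tsum_of_norm_bounded summable_bb.hasSum fun k => ?_
  simp [norm_ee]
end

section
/- The sum of integrals c₀ := −∑_{m=−∞}^{0} ∫₀¹ exp(−2^{x−m}) dx + ∑_{m=1}^{∞} ∫₀¹ (1 − exp(−2^{x−m})) dx converges and equals γ/ln 2, where γ is the Euler–Mascheroni constant. -/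
open Real MeasureTheory

open Set Filter Topology in
lemma aux_gamma_split {s : ℝ} (hs : 0 < s) :
    (Real.Gamma (1 + s) - Real.Gamma 1) / s =
      -(∫ t in Ioc (0:ℝ) 1, (1 - Real.exp (-t)) * t ^ (s - 1)) +
        ∫ t in Ioi (1:ℝ), Real.exp (-t) * t ^ (s - 1) := by
  have h1 : Real.Gamma (1 + s) = s * Real.Gamma s := by
    rw [add_comm, Real.Gamma_add_one hs.ne']
  have hint := Real.GammaIntegral_convergent hs
  have hA := hint.mono_set (Ioc_subset_Ioi_self : Ioc (0:ℝ) 1 ⊆ Ioi 0)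
  have hB := hint.mono_set (Ioi_subset_Ioi zero_le_one : Ioi (1:ℝ) ⊆ Ioi 0)
  have hp : IntegrableOn (fun t : ℝ => t ^ (s - 1)) (Ioc (0:ℝ) 1) := by
    rw [← intervalIntegrable_iff_integrableOn_Ioc_of_le zero_le_one]
    exact intervalIntegral.intervalIntegrable_rpow' (by linarith)
  have hpi : ∫ t in Ioc (0:ℝ) 1, t ^ (s - 1) = 1 / s := by
    rw [← intervalIntegral.integral_of_le zero_le_one, integral_rpow (Or.inl (by linarith))]
    simp [hs.ne']
  have h2 : Real.Gamma s = (∫ t in Ioc (0:ℝ) 1, Real.exp (-t) * t ^ (s - 1)) +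
      ∫ t in Ioi (1:ℝ), Real.exp (-t) * t ^ (s - 1) := by
    rw [Real.Gamma_eq_integral hs, ← Ioc_union_Ioi_eq_Ioi (zero_le_one : (0:ℝ) ≤ 1),
      setIntegral_union (by simp) measurableSet_Ioi hA hB]
  have h3 : ∫ t in Ioc (0:ℝ) 1, (1 - Real.exp (-t)) * t ^ (s - 1) =
      1 / s - ∫ t in Ioc (0:ℝ) 1, Real.exp (-t) * t ^ (s - 1) := by
    rw [← hpi, ← integral_sub hp hA]
    congr 1; ext t; ring
  rw [h3, h1, Real.Gamma_one]
  have : (s * Real.Gamma s - 1) / s = Real.Gamma s - 1 / s := by field_simp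
  rw [this, h2]; ring

lemma aux_exp_bd (t : ℝ) : 1 - Real.exp (-t) ≤ t := by
  have := Real.add_one_le_exp (-t); linarith

open Set Filter Topology in
lemma aux_gamma_eq :
    Real.eulerMascheroniConstant =
      (∫ t in Ioc (0:ℝ) 1, (1 - Real.exp (-t)) * t⁻¹) -
        ∫ t in Ioi (1:ℝ), Real.exp (-t) * t⁻¹ := by
  have hd : Tendsto (fun s : ℝ => (Real.Gamma (1 + s) - Real.Gamma 1) / s) (𝓝[>] 0)
      (𝓝 (-Real.eulerMascheroniConstant)) := by
    have := (hasDerivAt_iff_tendsto_slope_zero.1 Real.hasDerivAt_Gamma_one).mono_left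
      (nhdsWithin_mono (0:ℝ) (fun x (hx : 0 < x) => hx.ne'))
    refine this.congr fun s => ?_
    simp [div_eq_inv_mul]
  have hev : ∀ᶠ s : ℝ in 𝓝[>] 0, s ∈ Ioo (0:ℝ) 1 := Ioo_mem_nhdsGT zero_lt_one
  have hlim : ∀ t : ℝ, 0 < t → Tendsto (fun s : ℝ => t ^ (s - 1)) (𝓝[>] 0) (𝓝 t⁻¹) := by
    intro t ht
    have : ContinuousAt (fun s : ℝ => t ^ (s - 1)) 0 :=
      (Real.continuousAt_const_rpow ht.ne').comp (f := fun s : ℝ => s - 1) (by fun_prop)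
    have := this.tendsto.mono_left (nhdsWithin_le_nhds (s := Ioi (0:ℝ)))
    simpa [Real.rpow_neg_one] using this
  have hA : Tendsto (fun s : ℝ => ∫ t in Ioc (0:ℝ) 1, (1 - Real.exp (-t)) * t ^ (s - 1)) (𝓝[>] 0)
      (𝓝 (∫ t in Ioc (0:ℝ) 1, (1 - Real.exp (-t)) * t⁻¹)) := by
    refine tendsto_integral_filter_of_dominated_convergence (fun _ => 1) ?_ ?_ ?_ ?_
    · exact Eventually.of_forall fun s => by
        apply Measurable.aestronglyMeasurable; fun_prop
    · filter_upwards [hev] with s hs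
      refine (ae_restrict_iff' measurableSet_Ioc).2 (Eventually.of_forall fun t ht => ?_)
      have h0 : 0 ≤ 1 - Real.exp (-t) := by
        have : Real.exp (-t) ≤ 1 := Real.exp_le_one_iff.2 (by linarith [ht.1])
        linarith
      have h1 : 0 ≤ t ^ (s - 1) := Real.rpow_nonneg ht.1.le _
      rw [Real.norm_of_nonneg (mul_nonneg h0 h1)]
      calc _ ≤ t * t ^ (s - 1) := mul_le_mul_of_nonneg_right (aux_exp_bd t) h1
        _ = t ^ s := by rw [Real.rpow_sub_one ht.1.ne']; field_simp [ht.1.ne']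
        _ ≤ 1 := Real.rpow_le_one ht.1.le ht.2 hs.1.le
    · exact integrableOn_const (by simp)
    · refine (ae_restrict_iff' measurableSet_Ioc).2 (Eventually.of_forall fun t ht => ?_)
      exact (hlim t ht.1).const_mul _
  have hB : Tendsto (fun s : ℝ => ∫ t in Ioi (1:ℝ), Real.exp (-t) * t ^ (s - 1)) (𝓝[>] 0)
      (𝓝 (∫ t in Ioi (1:ℝ), Real.exp (-t) * t⁻¹)) := by
    refine tendsto_integral_filter_of_dominated_convergence (fun t => Real.exp (-t)) ?_ ?_ ?_ ?_
    · exact Eventually.of_forall fun s => by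
        apply Measurable.aestronglyMeasurable; fun_prop
    · filter_upwards [hev] with s hs
      refine (ae_restrict_iff' measurableSet_Ioi).2 (Eventually.of_forall fun t ht => ?_)
      have ht' : (1:ℝ) < t := ht
      have h1 : 0 ≤ t ^ (s - 1) := Real.rpow_nonneg (by linarith) _
      rw [Real.norm_of_nonneg (mul_nonneg (Real.exp_pos _).le h1)]
      exact mul_le_of_le_one_right (Real.exp_pos _).le
        (Real.rpow_le_one_of_one_le_of_nonpos ht'.le (by linarith [hs.2]))
    · exact integrableOn_exp_neg_Ioi 1
    · refine (ae_restrict_iff' measurableSet_Ioi).2 (Eventually.of_forall fun t ht => ?_)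
      exact (hlim t (zero_lt_one.trans ht)).const_mul _
  have hE := (hA.neg.add hB).congr' (f₂ := fun s : ℝ => (Real.Gamma (1 + s) - Real.Gamma 1) / s)
    (by filter_upwards [hev] with s hs using (aux_gamma_split hs.1).symm)
  have := tendsto_nhds_unique hd hE
  linarith

open Set in
lemma aux_contOn {g : ℝ → ℝ} (hg : Continuous g) {a b : ℝ} (ha : 0 < a) (hb : 0 < b) :
    IntervalIntegrable (fun t => g t * t⁻¹) volume a b := by
  apply ContinuousOn.intervalIntegrable
  intro t ht
  have : 0 < t := lt_of_lt_of_le (lt_min ha hb) ht.1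
  exact (hg.continuousAt.mul (continuousAt_inv₀ this.ne')).continuousWithinAt

open Set in
lemma aux_subst {g : ℝ → ℝ} (hg : Continuous g) (c : ℝ) :
    ∫ x in (0:ℝ)..1, g ((2:ℝ) ^ (x + c)) =
      (∫ t in ((2:ℝ) ^ c)..((2:ℝ) ^ (c + 1)), g t * t⁻¹) / Real.log 2 := by
  have hl : Real.log 2 ≠ 0 := (Real.log_pos one_lt_two).ne'
  have hcont : Continuous fun x : ℝ => (2:ℝ) ^ (x + c) :=
    Continuous.rpow continuous_const (by fun_prop) (fun _ => Or.inl (by norm_num))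
  have := intervalIntegral.integral_comp_mul_deriv' (a := 0) (b := 1)
    (f := fun x : ℝ => (2:ℝ) ^ (x + c)) (f' := fun x => Real.log 2 * (2:ℝ) ^ (x + c))
    (g := fun t => g t * t⁻¹) ?_ ?_ ?_
  · simp only [zero_add, add_comm (1:ℝ) c] at this
    rw [← this, eq_div_iff hl, ← intervalIntegral.integral_mul_const]
    congr 1; ext x
    have : (2:ℝ) ^ (x + c) ≠ 0 := (Real.rpow_pos_of_pos two_pos _).ne'
    simp only [Function.comp]
    field_simp
  · intro x _
    have := ((hasDerivAt_id x).add_const c).const_rpow (a := 2) two_pos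
    simpa using this
  · exact (continuous_const.mul hcont).continuousOn
  · rintro _ ⟨x, _, rfl⟩
    exact (hg.continuousAt.mul (continuousAt_inv₀
      (Real.rpow_pos_of_pos two_pos _).ne')).continuousWithinAt

open Set Filter Topology in
lemma aux_sum1 : HasSum (fun j : ℕ => ∫ x in (0 : ℝ)..1, Real.exp (-(2 : ℝ) ^ (x + j)))
    ((∫ t in Ioi (1:ℝ), Real.exp (-t) * t⁻¹) / Real.log 2) := by
  have hg : Continuous fun t : ℝ => Real.exp (-t) := by fun_prop
  rw [hasSum_iff_tendsto_nat_of_nonneg]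
  · have hS : ∀ n : ℕ, ∑ j ∈ Finset.range n, ∫ x in (0 : ℝ)..1, Real.exp (-(2 : ℝ) ^ (x + j)) =
        (∫ t in (1:ℝ)..(2:ℝ) ^ (n:ℝ), Real.exp (-t) * t⁻¹) / Real.log 2 := by
      intro n
      have := intervalIntegral.sum_integral_adjacent_intervals (μ := volume)
        (a := fun k : ℕ => (2:ℝ) ^ (k:ℝ)) (f := fun t => Real.exp (-t) * t⁻¹) (n := n)
        (fun k _ => aux_contOn hg (Real.rpow_pos_of_pos two_pos _) (Real.rpow_pos_of_pos two_pos _))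
      simp only [Nat.cast_zero, Real.rpow_zero, Nat.cast_succ] at this
      rw [← this, Finset.sum_div]
      exact Finset.sum_congr rfl fun j _ => aux_subst hg j
    simp only [hS]
    refine Tendsto.div_const (intervalIntegral_tendsto_integral_Ioi 1 ?_ ?_) _
    · refine Integrable.mono' (integrableOn_exp_neg_Ioi 1)
        (Measurable.aestronglyMeasurable (by fun_prop)) ?_
      refine (ae_restrict_iff' measurableSet_Ioi).2 (Eventually.of_forall fun t ht => ?_)
      have ht' : (1:ℝ) < t := ht
      rw [Real.norm_of_nonneg (by positivity)]
      exact mul_le_of_le_one_right (Real.exp_pos _).le (inv_le_one_of_one_le₀ ht'.le)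
    · simp only [Real.rpow_natCast]
      exact tendsto_pow_atTop_atTop_of_one_lt one_lt_two
  · intro j
    exact intervalIntegral.integral_nonneg zero_le_one fun x _ => (Real.exp_pos _).le

open Set Filter Topology in
lemma aux_sum2 : HasSum (fun j : ℕ =>
      ∫ x in (0 : ℝ)..1, (1 - Real.exp (-(2 : ℝ) ^ (x - (j + 1)))))
    ((∫ t in Ioc (0:ℝ) 1, (1 - Real.exp (-t)) * t⁻¹) / Real.log 2) := by
  have hg : Continuous fun t : ℝ => 1 - Real.exp (-t) := by fun_prop
  rw [hasSum_iff_tendsto_nat_of_nonneg]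
  · have hS : ∀ n : ℕ, ∑ j ∈ Finset.range n,
        ∫ x in (0 : ℝ)..1, (1 - Real.exp (-(2 : ℝ) ^ (x - (j + 1)))) =
        (∫ t in ((2:ℝ) ^ (-(n:ℝ)))..1, (1 - Real.exp (-t)) * t⁻¹) / Real.log 2 := by
      intro n
      have := intervalIntegral.sum_integral_adjacent_intervals (μ := volume)
        (a := fun k : ℕ => (2:ℝ) ^ (-(k:ℝ))) (f := fun t => (1 - Real.exp (-t)) * t⁻¹) (n := n)
        (fun k _ => aux_contOn hg (Real.rpow_pos_of_pos two_pos _) (Real.rpow_pos_of_pos two_pos _))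
      simp only [Nat.cast_zero, neg_zero, Real.rpow_zero, Nat.cast_succ] at this
      rw [intervalIntegral.integral_symm, ← this, ← Finset.sum_neg_distrib, Finset.sum_div]
      refine Finset.sum_congr rfl fun j _ => ?_
      have h := aux_subst hg (-((j:ℝ) + 1))
      rw [← intervalIntegral.integral_symm]
      simp only [← sub_eq_add_neg] at h
      rw [h]
      congr 3
      ring
    simp only [hS]
    refine Tendsto.div_const ?_ _
    have hint : IntegrableOn (fun t : ℝ => (1 - Real.exp (-t)) * t⁻¹) (uIcc 0 1) := by
      rw [uIcc_of_le zero_le_one]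
      refine Integrable.mono' (integrableOn_const (C := (1:ℝ)) (by simp))
        (Measurable.aestronglyMeasurable (by fun_prop)) ?_
      refine (ae_restrict_iff' measurableSet_Icc).2 (Eventually.of_forall fun t ht => ?_)
      have h0 : 0 ≤ 1 - Real.exp (-t) := by
        have : Real.exp (-t) ≤ 1 := Real.exp_le_one_iff.2 (by linarith [ht.1])
        linarith
      rw [Real.norm_of_nonneg (mul_nonneg h0 (inv_nonneg.2 ht.1)), ← div_eq_mul_inv]
      exact div_le_one_of_le₀ (aux_exp_bd t) ht.1
    rw [← intervalIntegral.integral_of_le zero_le_one]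
    have hc := intervalIntegral.continuousOn_primitive_interval_left hint 0 left_mem_uIcc
    refine hc.tendsto.comp (tendsto_nhdsWithin_iff.2 ⟨?_, ?_⟩)
    · have : ∀ n : ℕ, (2:ℝ) ^ (-(n:ℝ)) = (1/2) ^ n := by
        intro n
        rw [Real.rpow_neg two_pos.le, Real.rpow_natCast]; simp
      simp only [this]
      exact tendsto_pow_atTop_nhds_zero_of_lt_one (by norm_num) (by norm_num)
    · refine Eventually.of_forall fun n => ?_
      rw [uIcc_of_le zero_le_one]
      exact ⟨(Real.rpow_pos_of_pos two_pos _).le,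
        Real.rpow_le_one_of_one_le_of_nonpos one_le_two (by simp)⟩
  · intro j
    refine intervalIntegral.integral_nonneg zero_le_one fun x _ => ?_
    have : Real.exp (-(2 : ℝ) ^ (x - (j + 1))) ≤ 1 :=
      Real.exp_le_one_iff.2 (neg_nonpos.2 (Real.rpow_pos_of_pos two_pos _).le)
    linarith


/-- The constant
`c₀ = -∑_{m=-∞}^{0} ∫₀¹ exp(-2^{x-m}) dx + ∑_{m=1}^{∞} ∫₀¹ (1 - exp(-2^{x-m})) dx`
(both series converging) equals `γ / ln 2`. The first sum is reindexed by
`m = -j` and the second by `m = j+1`, `j : ℕ`. -/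
theorem c0_eq_gamma_div_log_two :
    Summable (fun j : ℕ => ∫ x in (0 : ℝ)..1, Real.exp (-(2 : ℝ) ^ (x + j))) ∧
    Summable (fun j : ℕ =>
      ∫ x in (0 : ℝ)..1, (1 - Real.exp (-(2 : ℝ) ^ (x - (j + 1))))) ∧
    -(∑' j : ℕ, ∫ x in (0 : ℝ)..1, Real.exp (-(2 : ℝ) ^ (x + j)))
        + ∑' j : ℕ, ∫ x in (0 : ℝ)..1, (1 - Real.exp (-(2 : ℝ) ^ (x - (j + 1)))) =
      Real.eulerMascheroniConstant / Real.log 2 := by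
  refine ⟨aux_sum1.summable, aux_sum2.summable, ?_⟩
  rw [aux_sum1.tsum_eq, aux_sum2.tsum_eq, aux_gamma_eq]
  ring
end

section
/- Let f(x) = ∑_{m=1}^{∞} (1 − (1 − 2^{−m})^{2^x}) for real x, and let h(x) = ∑_{m=−∞}^{∞} 2^{2x−2m} exp(−2^{x−m}). For every fixed real x with 0 ≤ x < 1, as the integer k → ∞, f(x+k) = x + k + γ/ln 2 − 1/2 + g(x) + h(x)·2^{−x−k−1} + O(2^{−2x−2k}); that is, the quantity 2^{2(x+k)} · (f(x+k) − (x + k + γ/ln 2 − 1/2 + g(x) + h(x)·2^{−x−k−1})) remains bounded as k → ∞. -/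
open Real Filter Asymptotics

/-- `f(x) = ∑_{m=1}^∞ (1 - (1 - 2^{-m})^{2^x})`, the sum over `m ≥ 1`
reindexed by `m = j+1`, `j : ℕ`; the exponent `2^x` is a real power. -/
noncomputable def f (x : ℝ) : ℝ :=
  ∑' j : ℕ, (1 - (1 - (2 : ℝ)⁻¹ ^ (j + 1)) ^ ((2 : ℝ) ^ x))

/-- `h(x) = ∑_{m=-∞}^{∞} 2^{2x-2m} exp(-2^{x-m})`, summed over all `m : ℤ`. -/
noncomputable def h (x : ℝ) : ℝ :=
  ∑' m : ℤ, (2 : ℝ) ^ (2 * x - 2 * (m : ℝ)) * Real.exp (-(2 : ℝ) ^ (x - (m : ℝ)))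

lemma exp_neg_bound (r : ℝ) (hr : 0 ≤ r) : |Real.exp (-r) - 1 + r| ≤ r ^ 2 := by
  have h1 := Real.add_one_le_exp (-r)
  have h2 := Real.add_one_le_exp r
  have h3 : Real.exp (-r) * Real.exp r = 1 := by rw [← Real.exp_add]; simp
  have h4 := Real.exp_pos (-r)
  rw [abs_le]
  constructor
  · nlinarith
  · have h5 : Real.exp (-r) * (r + 1) ≤ 1 := by nlinarith
    have h6 : (1 - r + r ^ 2) * (r + 1) ≥ 1 := by nlinarith [pow_nonneg hr 3]
    have h7 : Real.exp (-r) ≤ 1 - r + r ^ 2 := by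
      by_contra hc
      push Not at hc
      nlinarith
    linarith

lemma pointwise_bound (q n : ℝ) (hq : 0 < q) (hq2 : q ≤ 1 / 2) (hn : 0 < n) :
    |Real.exp (-(n * q)) - (1 - q) ^ n - (n * q) ^ 2 * Real.exp (-(n * q)) / (2 * n)|
      ≤ 3 * (((n * q) ^ 3 + (n * q) ^ 4) * Real.exp (-(n * q))) / n ^ 2 := by
  have hlog := Real.abs_log_sub_add_sum_range_le (x := q) (by rw [abs_of_pos hq]; linarith) 2
  simp only [Finset.sum_range_succ, Finset.sum_range_zero] at hlog
  rw [abs_of_pos hq] at hlog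
  norm_num at hlog
  have h2 : q ^ 3 / (1 - q) ≤ 2 * q ^ 3 := by
    rw [div_le_iff₀ (by linarith)]
    nlinarith [pow_pos hq 3]
  have h3 := hlog.trans h2
  rw [abs_le] at h3
  obtain ⟨h3, h4⟩ := h3
  have h5 : Real.log (1 - q) ≤ -q := by
    have := Real.log_le_sub_one_of_pos (x := 1 - q) (by linarith)
    linarith
  obtain ⟨r, hr⟩ : ∃ r, r = n * (-Real.log (1 - q) - q) := ⟨_, rfl⟩
  have hr0 : 0 ≤ r := by rw [hr]; apply mul_nonneg hn.le; linarith
  have hpow : (1 - q) ^ n = Real.exp (-(n * q)) * Real.exp (-r) := by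
    rw [Real.rpow_def_of_pos (by linarith), ← Real.exp_add, hr]
    congr 1; ring
  have hr1 : |r - n * q ^ 2 / 2| ≤ 2 * (n * q ^ 3) := by
    rw [hr, abs_le]
    constructor <;> nlinarith
  have hr2 : r ≤ 3 / 2 * (n * q ^ 2) := by
    have := (abs_le.1 hr1).2
    have h6 : n * q ^ 3 ≤ n * q ^ 2 * (1 / 2) := by
      have : 0 < n * q ^ 2 := by positivity
      nlinarith
    linarith
  have hr3 : r ^ 2 ≤ 9 / 4 * (n ^ 2 * q ^ 4) := by
    calc r ^ 2 ≤ (3 / 2 * (n * q ^ 2)) ^ 2 := by gcongr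
      _ = _ := by ring
  have he := exp_neg_bound r hr0
  have key : |Real.exp (-r) - 1 + n * q ^ 2 / 2| ≤ 3 * (n * q ^ 3 + n ^ 2 * q ^ 4) := by
    have p1 : 0 < n * q ^ 3 := by positivity
    have p2 : 0 < n ^ 2 * q ^ 4 := by positivity
    rw [abs_le] at *
    constructor <;> linarith [he.1, he.2, hr1.1, hr1.2]
  have e1 : Real.exp (-(n * q)) - (1 - q) ^ n - (n * q) ^ 2 * Real.exp (-(n * q)) / (2 * n)
      = -(Real.exp (-(n * q)) * (Real.exp (-r) - 1 + n * q ^ 2 / 2)) := by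
    rw [hpow]; field_simp; ring
  have e2 : 3 * (((n * q) ^ 3 + (n * q) ^ 4) * Real.exp (-(n * q))) / n ^ 2
      = Real.exp (-(n * q)) * (3 * (n * q ^ 3 + n ^ 2 * q ^ 4)) := by
    field_simp
  rw [e1, e2, abs_neg, abs_mul, abs_of_pos (Real.exp_pos _)]
  exact mul_le_mul_of_nonneg_left key (Real.exp_pos _).le

lemma pow_exp_le (t : ℝ) (ht : 0 ≤ t) (p : ℕ) :
    t ^ p * Real.exp (-t) ≤ p.factorial := by
  have h1 := Real.pow_div_factorial_le_exp t ht p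
  have h3 : Real.exp (-t) * Real.exp t = 1 := by rw [← Real.exp_add]; simp
  have h4 := Real.exp_pos (-t)
  have hp : (0 : ℝ) < p.factorial := by positivity
  rw [div_le_iff₀ hp] at h1
  nlinarith

lemma two_rpow_sub_nat (x : ℝ) (n : ℕ) : (2 : ℝ) ^ (x - n) = 2 ^ x * (1 / 2) ^ n := by
  rw [Real.rpow_sub (by norm_num), Real.rpow_natCast]; simp; rfl

lemma two_rpow_add_nat (x : ℝ) (n : ℕ) : ((2 : ℝ) ^ (x + n))⁻¹ = (2 ^ x)⁻¹ * (1 / 2) ^ n := by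
  rw [Real.rpow_add (by norm_num), Real.rpow_natCast]; simp [mul_comm]

lemma summable_pow_exp (x : ℝ) (p : ℕ) :
    Summable (fun m : ℤ => ((2 : ℝ) ^ (x - (m : ℝ))) ^ (p + 1)
      * Real.exp (-(2 : ℝ) ^ (x - (m : ℝ)))) := by
  have hg : Summable (fun n : ℕ => (1 / 2 : ℝ) ^ n) := summable_geometric_two
  apply Summable.of_nat_of_neg
  · refine Summable.of_nonneg_of_le (fun n => by positivity) (fun n => ?_)
      (hg.mul_left ((p.factorial : ℝ) * 2 ^ x))
    have ht : (0 : ℝ) < 2 ^ (x - ((n : ℤ) : ℝ)) := by positivity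
    have := pow_exp_le _ ht.le p
    have e := two_rpow_sub_nat x n
    push_cast at *
    rw [mul_assoc, ← e, pow_succ]
    nlinarith
  · refine Summable.of_nonneg_of_le (fun n => by positivity) (fun n => ?_)
      (hg.mul_left (((p + 2).factorial : ℝ) * (2 ^ x)⁻¹))
    have ht : (0 : ℝ) < 2 ^ (x - ((-(n : ℤ) : ℤ) : ℝ)) := by positivity
    have := pow_exp_le _ ht.le (p + 2)
    have e := two_rpow_add_nat x n
    push_cast at *
    rw [sub_neg_eq_add] at *
    rw [mul_assoc, ← e, ← div_eq_mul_inv, le_div_iff₀ ht]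
    refine le_trans (le_of_eq ?_) this
    ring

/-- Second-order asymptotics:
`f(x+k) = x + k + γ/ln 2 - 1/2 + g(x) + h(x)·2^{-x-k-1} + O(2^{-2x-2k})`
as the integer `k → ∞`, for each fixed `0 ≤ x < 1`. -/
theorem f_second_order_asymptotics (x : ℝ) (hx0 : 0 ≤ x) (hx1 : x < 1) :
    (fun k : ℕ =>
        f (x + k) - (x + k + Real.eulerMascheroniConstant / Real.log 2 - 1 / 2
          + g x + h x * (2 : ℝ) ^ (-x - k - 1))) =O[atTop]
      fun k : ℕ => (2 : ℝ) ^ (-2 * x - 2 * k) := by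
  obtain ⟨t, ht⟩ : ∃ t : ℤ → ℝ, t = fun m : ℤ => (2 : ℝ) ^ (x - (m : ℝ)) := ⟨_, rfl⟩
  have htpos : ∀ m, 0 < t m := fun m => by rw [ht]; positivity
  have hS : ∀ p : ℕ, Summable (fun m : ℤ => t m ^ (p + 1) * Real.exp (-t m)) := by
    intro p; rw [ht]; exact summable_pow_exp x p
  -- the three sums
  have hh : HasSum (fun m : ℤ => t m ^ 2 * Real.exp (-t m)) (h x) := by
    have e : h x = ∑' m : ℤ, t m ^ 2 * Real.exp (-t m) := by
      unfold h
      refine tsum_congr fun m => ?_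
      rw [ht]
      simp only
      rw [← Real.rpow_natCast ((2 : ℝ) ^ (x - (m : ℝ))) 2, ← Real.rpow_mul (by norm_num)]
      congr 2
      push_cast
      ring
    rw [e]
    exact (hS 1).hasSum
  obtain ⟨A1, hA1⟩ : ∃ A1, A1 = ∑' j : ℕ, (1 - Real.exp (-(2 : ℝ) ^ (x - (j + 1)))) := ⟨_, rfl⟩
  obtain ⟨A2, hA2⟩ : ∃ A2, A2 = ∑' j : ℕ, Real.exp (-(2 : ℝ) ^ (x + j)) := ⟨_, rfl⟩
  obtain ⟨a1, ha1⟩ : ∃ a1 : ℤ → ℝ, a1 = fun m : ℤ => if 1 ≤ m then 1 - Real.exp (-t m) else 0 :=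
    ⟨_, rfl⟩
  obtain ⟨a2, ha2⟩ : ∃ a2 : ℤ → ℝ, a2 = fun m : ℤ => if 1 ≤ m then 0 else Real.exp (-t m) :=
    ⟨_, rfl⟩
  have hg : Summable (fun n : ℕ => (1 / 2 : ℝ) ^ n) := summable_geometric_two
  have hs1 : HasSum a1 A1 := by
    have hinj : Function.Injective (fun j : ℕ => (j : ℤ) + 1) := fun a b hab => by
      simp only at hab; omega
    rw [← hinj.hasSum_iff]
    · have e : a1 ∘ (fun j : ℕ => (j : ℤ) + 1)
          = fun j : ℕ => (1 - Real.exp (-(2 : ℝ) ^ (x - (j + 1)))) := by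
        funext j
        simp only [ha1, ht, Function.comp]
        rw [if_pos (by omega)]
        push_cast; rfl
      rw [e, hA1]
      apply Summable.hasSum
      refine Summable.of_nonneg_of_le (fun n => ?_) (fun n => ?_) (hg.mul_left (2 ^ (x - 1)))
      · have : (0 : ℝ) < 2 ^ (x - (n + 1)) := by positivity
        have := Real.exp_le_one_iff.2 (neg_nonpos.2 this.le)
        linarith
      · rw [← two_rpow_sub_nat, show x - 1 - (n : ℝ) = x - (n + 1) by ring]
        linarith [Real.add_one_le_exp (-(2 : ℝ) ^ (x - ((n : ℝ) + 1)))]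
    · intro m hm
      rw [ha1]
      simp only
      rw [if_neg]
      intro h1
      exact hm ⟨(m - 1).toNat, by simp only; omega⟩
  have hs2 : HasSum a2 A2 := by
    have hinj : Function.Injective (fun j : ℕ => -(j : ℤ)) := fun a b hab => by
      simp only at hab; omega
    rw [← hinj.hasSum_iff]
    · have e : a2 ∘ (fun j : ℕ => -(j : ℤ))
          = fun j : ℕ => Real.exp (-(2 : ℝ) ^ (x + j)) := by
        funext j
        simp only [ha2, ht, Function.comp]
        rw [if_neg (by omega)]
        push_cast; rw [sub_neg_eq_add]
      rw [e, hA2]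
      apply Summable.hasSum
      refine Summable.of_nonneg_of_le (fun n => by positivity) (fun n => ?_)
        (hg.mul_left ((2 ^ x)⁻¹))
      rw [← two_rpow_add_nat]
      have hp : (0 : ℝ) < 2 ^ (x + n) := by positivity
      have := pow_exp_le _ hp.le 1
      rw [← one_div, le_div_iff₀ hp]
      simp at this
      linarith
    · intro m hm
      rw [ha2]
      simp only
      rw [if_pos]
      by_contra h1
      exact hm ⟨(-m).toNat, by simp only; omega⟩
  -- the dominating series
  obtain ⟨F, hF⟩ : ∃ F : ℤ → ℝ, F = fun m : ℤ =>
      3 * (t m ^ 2 * Real.exp (-t m) + t m ^ 3 * Real.exp (-t m) + t m ^ 4 * Real.exp (-t m)) :=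
    ⟨_, rfl⟩
  have hFs : Summable F := by
    rw [hF]; exact (((hS 1).add (hS 2)).add (hS 3)).mul_left 3
  refine IsBigO.of_bound (∑' m, F m) (Eventually.of_forall fun k => ?_)
  obtain ⟨n, hn⟩ : ∃ n : ℝ, n = 2 ^ (x + k) := ⟨_, rfl⟩
  have hnpos : 0 < n := by rw [hn]; positivity
  have hn2 : (2 : ℝ) ^ (-2 * x - 2 * k) = 1 / n ^ 2 := by
    rw [hn, ← Real.rpow_natCast ((2 : ℝ) ^ (x + (k : ℝ))) 2, ← Real.rpow_mul (by norm_num),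
      one_div, ← Real.rpow_neg (by norm_num)]
    congr 1; push_cast; ring
  have hn1 : (2 : ℝ) ^ (-x - k - 1) = 1 / (2 * n) := by
    rw [hn, show -x - (k : ℝ) - 1 = -(x + k) - 1 by ring, Real.rpow_sub (by norm_num),
      Real.rpow_neg (by norm_num), Real.rpow_one]
    field_simp
  obtain ⟨c, hc⟩ : ∃ c : ℤ → ℝ, c = fun m : ℤ => if m ∈ Finset.Ioc (-(k : ℤ)) 0 then 1 else 0 :=
    ⟨_, rfl⟩
  have hsc : HasSum c k := by
    have := hasSum_sum_of_ne_finset_zero (L := SummationFilter.unconditional ℤ) (f := c) (s := Finset.Ioc (-(k : ℤ)) 0)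
      (fun m hm => by rw [hc]; simp only; rw [if_neg hm])
    convert this using 1
    rw [hc, Finset.sum_congr rfl (fun m hm => if_pos hm)]
    simp
  obtain ⟨b, hb⟩ : ∃ b : ℤ → ℝ, b = fun m : ℤ => if 1 - (k : ℤ) ≤ m then
      1 - (1 - t m / n) ^ n else 0 := ⟨_, rfl⟩
  obtain ⟨d, hd⟩ : ∃ d : ℤ → ℝ, d = fun m => b m - c m - a1 m + a2 m
      - t m ^ 2 * Real.exp (-t m) * (1 / (2 * n)) := ⟨_, rfl⟩
  have hq : ∀ m, t m / n = (2 : ℝ) ^ (-(m : ℝ) - k) := by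
    intro m
    rw [ht, hn, ← Real.rpow_sub (by norm_num)]
    congr 1; ring
  have hdF : ∀ m, ‖d m‖ ≤ F m * (1 / n ^ 2) := by
    intro m
    have hE := Real.exp_pos (-t m)
    have hT := htpos m
    rw [Real.norm_eq_abs]
    by_cases hm : 1 - (k : ℤ) ≤ m
    · have hq2 : t m / n ≤ 1 / 2 := by
        rw [hq, one_div, ← Real.rpow_neg_one]
        apply Real.rpow_le_rpow_of_exponent_le (by norm_num)
        have : (1 : ℝ) - k ≤ m := by exact_mod_cast hm
        linarith
      have hpb := pointwise_bound (t m / n) n (by positivity) hq2 hnpos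
      rw [mul_div_cancel₀ _ hnpos.ne'] at hpb
      have e : d m = Real.exp (-t m) - (1 - t m / n) ^ n
          - t m ^ 2 * Real.exp (-t m) / (2 * n) := by
        simp only [hd, hb, hc, ha1, ha2]
        rw [if_pos hm]
        by_cases h1 : 1 ≤ m
        · rw [if_neg (by rw [Finset.mem_Ioc]; omega), if_pos h1, if_pos h1]; ring
        · rw [if_pos (by rw [Finset.mem_Ioc]; omega), if_neg h1, if_neg h1]; ring
      rw [e]
      refine hpb.trans ?_
      rw [hF, mul_one_div]
      simp only
      apply div_le_div_of_nonneg_right _ (by positivity)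
      have : 0 ≤ t m ^ 2 * Real.exp (-t m) := by positivity
      linarith
    · have e : d m = Real.exp (-t m) - t m ^ 2 * Real.exp (-t m) * (1 / (2 * n)) := by
        simp only [hd, hb, hc, ha1, ha2]
        rw [if_neg hm, if_neg (by rw [Finset.mem_Ioc]; omega), if_neg (by omega),
          if_neg (by omega)]
        ring
      have hnt : n ≤ t m := by
        rw [hn, ht]
        apply Real.rpow_le_rpow_of_exponent_le (by norm_num)
        have : (m : ℝ) ≤ -k := by exact_mod_cast (by omega : m ≤ -(k : ℤ))
        linarith
      have b1 : Real.exp (-t m) ≤ t m ^ 2 * Real.exp (-t m) * (1 / n ^ 2) := by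
        rw [mul_one_div, le_div_iff₀ (by positivity), mul_comm]
        gcongr
      have b2 : t m ^ 2 * Real.exp (-t m) * (1 / (2 * n))
          ≤ t m ^ 3 * Real.exp (-t m) * (1 / n ^ 2) := by
        rw [mul_one_div, mul_one_div, div_le_div_iff₀ (by positivity) (by positivity)]
        have : 0 < t m ^ 2 * Real.exp (-t m) * n := by positivity
        nlinarith
      have b3 : 0 ≤ t m ^ 2 * Real.exp (-t m) * (1 / (2 * n)) := by positivity
      have b4 : 0 ≤ t m ^ 4 * Real.exp (-t m) * (1 / n ^ 2) := by positivity
      rw [e, hF]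
      simp only
      rw [abs_le]
      constructor <;> nlinarith
  have hds : Summable d := Summable.of_norm_bounded (hFs.mul_right _) hdF
  have hbs : HasSum b (tsum d + k + A1 - A2 + h x * (1 / (2 * n))) := by
    have := ((((hds.hasSum.add hsc).add hs1).sub hs2).add (hh.mul_right (1 / (2 * n))))
    have e : b = fun m => d m + c m + a1 m - a2 m
        + t m ^ 2 * Real.exp (-t m) * (1 / (2 * n)) := by
      funext m
      rw [hd]
      simp only
      ring
    rw [e]
    exact this
  have hf : f (x + k) = tsum d + k + A1 - A2 + h x * (1 / (2 * n)) := by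
    have hinj : Function.Injective (fun j : ℕ => (j : ℤ) + 1 - k) := fun a b hab => by
      simp only at hab; omega
    rw [← hinj.hasSum_iff] at hbs
    · rw [← hbs.tsum_eq]
      unfold f
      refine tsum_congr fun j => ?_
      simp only [hb, Function.comp]
      rw [if_pos (by omega), hq, hn]
      have : (2 : ℝ)⁻¹ ^ (j + 1) = 2 ^ (-(((j : ℤ) + 1 - k : ℤ) : ℝ) - k) := by
        push_cast
        rw [show -((j : ℝ) + 1 - k) - k = -((j + 1 : ℕ) : ℝ) by push_cast; ring,
          Real.rpow_neg (by norm_num), Real.rpow_natCast, inv_pow]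
      rw [this]
    · intro m hm
      simp only [hb]
      rw [if_neg]
      intro h1
      exact hm ⟨(m - 1 + k).toNat, by simp only; omega⟩
  have hfin : f (x + k) - (x + k + Real.eulerMascheroniConstant / Real.log 2 - 1 / 2
          + g x + h x * (2 : ℝ) ^ (-x - k - 1)) = tsum d := by
    rw [hf, hn1]
    unfold g
    rw [← hA1, ← hA2]
    ring
  rw [hfin, hn2, Real.norm_of_nonneg (by positivity : 0 ≤ 1 / n ^ 2), ← tsum_mul_right]
  exact tsum_of_norm_bounded (hFs.mul_right _).hasSum hdF
end
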